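/- arXiv:1801.00378 — 2 statements merged into one kernel-verified Lean document; each statement's English description precedes it below -/
import Mathlib

section
/- Piecewise valuation of Q₄ = A·B − 4C on the theta cone: Assume α₁,…,α₆ ∈ K are pairwise distinct and nonzero with ω_i := −val(α_i) satisfying ω₁ < ω₂ < ω₃ = ω₄ < ω₅ < ω₆ and d₃₄ := −val(α₃ − α₄) < ω₃, and assume val(2) = 0. Then: (i) if d₃₄ > ω₂ and ω₅ + d₃₄ > 2ω₃, then val(A·B − 4C) = −(6ω₆ + 6ω₅ + 2d₃₄ + 4ω₃) and val(A·B − 4C + 8α₆⁶α₅⁶(α₄ − α₃)²α₃⁴) > val(A·B − 4C); (ii) if 2ω₃ > ω₅ + ω₂ and 2ω₃ > ω₅ + d₃₄, then val(A·B − 4C) = −(6ω₆ + 4ω₅ + 8ω₃) and val(A·B − 4C + 8α₆⁶α₅⁴α₃⁸) > val(A·B − 4C); (iii) if ω₂ > d₃₄ and ω₅ + ω₂ > 2ω₃, then val(A·B − 4C) = −(6ω₆ + 6ω₅ + 4ω₃ + 2ω₂) and val(A·B − 4C + 8α₆⁶α₅⁶α₃⁴α₂²) > val(A·B − 4C). 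-/
namespace Genus2Igusa

variable {R : Type*} [CommRing R]

/-- `Δ_{ij} = (x − y)²`. -/
def dlt (x y : R) : R := (x - y) ^ 2

/-- Triangle product `Δ_{ij}Δ_{jk}Δ_{ki}`. -/
def tri (x y z : R) : R := dlt x y * dlt y z * dlt z x

/-- Sum over the six bijections between `{i,j,k}` and `{l,m,n}` of
`Δ_{i,σ(i)}Δ_{j,σ(j)}Δ_{k,σ(k)}`. -/
def mtch (i j k l m n : R) : R :=
  dlt i l * dlt j m * dlt k n + dlt i l * dlt j n * dlt k m +
    dlt i m * dlt j l * dlt k n + dlt i m * dlt j n * dlt k l +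
    dlt i n * dlt j l * dlt k m + dlt i n * dlt j m * dlt k l

/-- `A`: sum of `Δ_{ij}Δ_{kl}Δ_{mn}` over the 15 partitions of `{1,…,6}` into three
pairs `{i,j},{k,l},{m,n}`. -/
def igusaA (a₁ a₂ a₃ a₄ a₅ a₆ : R) : R :=
  dlt a₁ a₂ * dlt a₃ a₄ * dlt a₅ a₆ + dlt a₁ a₂ * dlt a₃ a₅ * dlt a₄ a₆ +
    dlt a₁ a₂ * dlt a₃ a₆ * dlt a₄ a₅ +
  dlt a₁ a₃ * dlt a₂ a₄ * dlt a₅ a₆ + dlt a₁ a₃ * dlt a₂ a₅ * dlt a₄ a₆ +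
    dlt a₁ a₃ * dlt a₂ a₆ * dlt a₄ a₅ +
  dlt a₁ a₄ * dlt a₂ a₃ * dlt a₅ a₆ + dlt a₁ a₄ * dlt a₂ a₅ * dlt a₃ a₆ +
    dlt a₁ a₄ * dlt a₂ a₆ * dlt a₃ a₅ +
  dlt a₁ a₅ * dlt a₂ a₃ * dlt a₄ a₆ + dlt a₁ a₅ * dlt a₂ a₄ * dlt a₃ a₆ +
    dlt a₁ a₅ * dlt a₂ a₆ * dlt a₃ a₄ +
  dlt a₁ a₆ * dlt a₂ a₃ * dlt a₄ a₅ + dlt a₁ a₆ * dlt a₂ a₄ * dlt a₃ a₅ +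
    dlt a₁ a₆ * dlt a₂ a₅ * dlt a₃ a₄

/-- `B`: sum of `(Δ_{ij}Δ_{jk}Δ_{ki})(Δ_{lm}Δ_{mn}Δ_{nl})` over the 10 partitions of
`{1,…,6}` into two 3-element sets `{i,j,k},{l,m,n}`. -/
def igusaB (a₁ a₂ a₃ a₄ a₅ a₆ : R) : R :=
  tri a₁ a₂ a₃ * tri a₄ a₅ a₆ + tri a₁ a₂ a₄ * tri a₃ a₅ a₆ +
    tri a₁ a₂ a₅ * tri a₃ a₄ a₆ + tri a₁ a₂ a₆ * tri a₃ a₄ a₅ +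
    tri a₁ a₃ a₄ * tri a₂ a₅ a₆ + tri a₁ a₃ a₅ * tri a₂ a₄ a₆ +
    tri a₁ a₃ a₆ * tri a₂ a₄ a₅ + tri a₁ a₄ a₅ * tri a₂ a₃ a₆ +
    tri a₁ a₄ a₆ * tri a₂ a₃ a₅ + tri a₁ a₅ a₆ * tri a₂ a₃ a₄

/-- `C`: sum of `(Δ_{ij}Δ_{jk}Δ_{ki})(Δ_{lm}Δ_{mn}Δ_{nl})(Δ_{il}Δ_{jm}Δ_{kn})` over the
60 pairs consisting of a partition of `{1,…,6}` into two 3-element sets together with a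
bijection between them. -/
def igusaC (a₁ a₂ a₃ a₄ a₅ a₆ : R) : R :=
  tri a₁ a₂ a₃ * tri a₄ a₅ a₆ * mtch a₁ a₂ a₃ a₄ a₅ a₆ +
    tri a₁ a₂ a₄ * tri a₃ a₅ a₆ * mtch a₁ a₂ a₄ a₃ a₅ a₆ +
    tri a₁ a₂ a₅ * tri a₃ a₄ a₆ * mtch a₁ a₂ a₅ a₃ a₄ a₆ +
    tri a₁ a₂ a₆ * tri a₃ a₄ a₅ * mtch a₁ a₂ a₆ a₃ a₄ a₅ +
    tri a₁ a₃ a₄ * tri a₂ a₅ a₆ * mtch a₁ a₃ a₄ a₂ a₅ a₆ +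
    tri a₁ a₃ a₅ * tri a₂ a₄ a₆ * mtch a₁ a₃ a₅ a₂ a₄ a₆ +
    tri a₁ a₃ a₆ * tri a₂ a₄ a₅ * mtch a₁ a₃ a₆ a₂ a₄ a₅ +
    tri a₁ a₄ a₅ * tri a₂ a₃ a₆ * mtch a₁ a₄ a₅ a₂ a₃ a₆ +
    tri a₁ a₄ a₆ * tri a₂ a₃ a₅ * mtch a₁ a₄ a₆ a₂ a₃ a₅ +
    tri a₁ a₅ a₆ * tri a₂ a₃ a₄ * mtch a₁ a₅ a₆ a₂ a₃ a₄

/-- `D`: product of all `Δ_{ij}` for `1 ≤ i < j ≤ 6`. -/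
def igusaD (a₁ a₂ a₃ a₄ a₅ a₆ : R) : R :=
  dlt a₁ a₂ * dlt a₁ a₃ * dlt a₁ a₄ * dlt a₁ a₅ * dlt a₁ a₆ *
    dlt a₂ a₃ * dlt a₂ a₄ * dlt a₂ a₅ * dlt a₂ a₆ *
    dlt a₃ a₄ * dlt a₃ a₅ * dlt a₃ a₆ *
    dlt a₄ a₅ * dlt a₄ a₆ * dlt a₅ a₆

def gA (D : Fin 6 → Fin 6 → R) : R :=
  D 0 1 * D 2 3 * D 4 5 + D 0 1 * D 2 4 * D 3 5 +
    D 0 1 * D 2 5 * D 3 4 +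
  D 0 2 * D 1 3 * D 4 5 + D 0 2 * D 1 4 * D 3 5 +
    D 0 2 * D 1 5 * D 3 4 +
  D 0 3 * D 1 2 * D 4 5 + D 0 3 * D 1 4 * D 2 5 +
    D 0 3 * D 1 5 * D 2 4 +
  D 0 4 * D 1 2 * D 3 5 + D 0 4 * D 1 3 * D 2 5 +
    D 0 4 * D 1 5 * D 2 3 +
  D 0 5 * D 1 2 * D 3 4 + D 0 5 * D 1 3 * D 2 4 +
    D 0 5 * D 1 4 * D 2 3

def gB (D : Fin 6 → Fin 6 → R) : R :=
  (D 0 1 * D 1 2 * D 2 0) * (D 3 4 * D 4 5 * D 5 3) + (D 0 1 * D 1 3 * D 3 0) * (D 2 4 * D 4 5 * D 5 2) +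
    (D 0 1 * D 1 4 * D 4 0) * (D 2 3 * D 3 5 * D 5 2) + (D 0 1 * D 1 5 * D 5 0) * (D 2 3 * D 3 4 * D 4 2) +
    (D 0 2 * D 2 3 * D 3 0) * (D 1 4 * D 4 5 * D 5 1) + (D 0 2 * D 2 4 * D 4 0) * (D 1 3 * D 3 5 * D 5 1) +
    (D 0 2 * D 2 5 * D 5 0) * (D 1 3 * D 3 4 * D 4 1) + (D 0 3 * D 3 4 * D 4 0) * (D 1 2 * D 2 5 * D 5 1) +
    (D 0 3 * D 3 5 * D 5 0) * (D 1 2 * D 2 4 * D 4 1) + (D 0 4 * D 4 5 * D 5 0) * (D 1 2 * D 2 3 * D 3 1)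

def gC (D : Fin 6 → Fin 6 → R) : R :=
  (D 0 1 * D 1 2 * D 2 0) * (D 3 4 * D 4 5 * D 5 3) * (D 0 3 * D 1 4 * D 2 5 + D 0 3 * D 1 5 * D 2 4 + D 0 4 * D 1 3 * D 2 5 + D 0 4 * D 1 5 * D 2 3 + D 0 5 * D 1 3 * D 2 4 + D 0 5 * D 1 4 * D 2 3) +
    (D 0 1 * D 1 3 * D 3 0) * (D 2 4 * D 4 5 * D 5 2) * (D 0 2 * D 1 4 * D 3 5 + D 0 2 * D 1 5 * D 3 4 + D 0 4 * D 1 2 * D 3 5 + D 0 4 * D 1 5 * D 3 2 + D 0 5 * D 1 2 * D 3 4 + D 0 5 * D 1 4 * D 3 2) +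
    (D 0 1 * D 1 4 * D 4 0) * (D 2 3 * D 3 5 * D 5 2) * (D 0 2 * D 1 3 * D 4 5 + D 0 2 * D 1 5 * D 4 3 + D 0 3 * D 1 2 * D 4 5 + D 0 3 * D 1 5 * D 4 2 + D 0 5 * D 1 2 * D 4 3 + D 0 5 * D 1 3 * D 4 2) +
    (D 0 1 * D 1 5 * D 5 0) * (D 2 3 * D 3 4 * D 4 2) * (D 0 2 * D 1 3 * D 5 4 + D 0 2 * D 1 4 * D 5 3 + D 0 3 * D 1 2 * D 5 4 + D 0 3 * D 1 4 * D 5 2 + D 0 4 * D 1 2 * D 5 3 + D 0 4 * D 1 3 * D 5 2) +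
    (D 0 2 * D 2 3 * D 3 0) * (D 1 4 * D 4 5 * D 5 1) * (D 0 1 * D 2 4 * D 3 5 + D 0 1 * D 2 5 * D 3 4 + D 0 4 * D 2 1 * D 3 5 + D 0 4 * D 2 5 * D 3 1 + D 0 5 * D 2 1 * D 3 4 + D 0 5 * D 2 4 * D 3 1) +
    (D 0 2 * D 2 4 * D 4 0) * (D 1 3 * D 3 5 * D 5 1) * (D 0 1 * D 2 3 * D 4 5 + D 0 1 * D 2 5 * D 4 3 + D 0 3 * D 2 1 * D 4 5 + D 0 3 * D 2 5 * D 4 1 + D 0 5 * D 2 1 * D 4 3 + D 0 5 * D 2 3 * D 4 1) +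
    (D 0 2 * D 2 5 * D 5 0) * (D 1 3 * D 3 4 * D 4 1) * (D 0 1 * D 2 3 * D 5 4 + D 0 1 * D 2 4 * D 5 3 + D 0 3 * D 2 1 * D 5 4 + D 0 3 * D 2 4 * D 5 1 + D 0 4 * D 2 1 * D 5 3 + D 0 4 * D 2 3 * D 5 1) +
    (D 0 3 * D 3 4 * D 4 0) * (D 1 2 * D 2 5 * D 5 1) * (D 0 1 * D 3 2 * D 4 5 + D 0 1 * D 3 5 * D 4 2 + D 0 2 * D 3 1 * D 4 5 + D 0 2 * D 3 5 * D 4 1 + D 0 5 * D 3 1 * D 4 2 + D 0 5 * D 3 2 * D 4 1) +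
    (D 0 3 * D 3 5 * D 5 0) * (D 1 2 * D 2 4 * D 4 1) * (D 0 1 * D 3 2 * D 5 4 + D 0 1 * D 3 4 * D 5 2 + D 0 2 * D 3 1 * D 5 4 + D 0 2 * D 3 4 * D 5 1 + D 0 4 * D 3 1 * D 5 2 + D 0 4 * D 3 2 * D 5 1) +
    (D 0 4 * D 4 5 * D 5 0) * (D 1 2 * D 2 3 * D 3 1) * (D 0 1 * D 4 2 * D 5 3 + D 0 1 * D 4 3 * D 5 2 + D 0 2 * D 4 1 * D 5 3 + D 0 2 * D 4 3 * D 5 1 + D 0 3 * D 4 1 * D 5 2 + D 0 3 * D 4 2 * D 5 1)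

lemma igusaA_eq (a : Fin 6 → R) :
    igusaA (a 0) (a 1) (a 2) (a 3) (a 4) (a 5) = gA (fun i j => (a i - a j) ^ 2) := rfl

lemma igusaB_eq (a : Fin 6 → R) :
    igusaB (a 0) (a 1) (a 2) (a 3) (a 4) (a 5) = gB (fun i j => (a i - a j) ^ 2) := rfl

lemma igusaC_eq (a : Fin 6 → R) :
    igusaC (a 0) (a 1) (a 2) (a 3) (a 4) (a 5) = gC (fun i j => (a i - a j) ^ 2) := rfl

lemma gA_scale (D : Fin 6 → Fin 6 → R) (s : Fin 6 → R) :
    gA (fun i j => s i * s j * D i j) = (s 0 * s 1 * s 2 * s 3 * s 4 * s 5) * gA D := by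
  simp only [gA]; ring

lemma gB_scale (D : Fin 6 → Fin 6 → R) (s : Fin 6 → R) :
    gB (fun i j => s i * s j * D i j) = (s 0 * s 1 * s 2 * s 3 * s 4 * s 5) ^ 2 * gB D := by
  simp only [gB]; ring

lemma gC_scale (D : Fin 6 → Fin 6 → R) (s : Fin 6 → R) :
    gC (fun i j => s i * s j * D i j) = (s 0 * s 1 * s 2 * s 3 * s 4 * s 5) ^ 3 * gC D := by
  simp only [gC]; ring

/-- squared bracket of the projective points `0, x, y, y+e, z, ∞` -/
def projD (x y e z : R) (i j : Fin 6) : R :=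
  ((![0, x, y, y + e, z, 1] : Fin 6 → R) i * (![1, 1, 1, 1, 1, 0] : Fin 6 → R) j
    - (![0, x, y, y + e, z, 1] : Fin 6 → R) j * (![1, 1, 1, 1, 1, 0] : Fin 6 → R) i) ^ 2

/-- coefficient and exponents of `x, y, e, z` -/
def restL : List (ℤ × ℕ × ℕ × ℕ × ℕ) := [
  (-8,0,2,4,6), (8,0,2,5,5), (-8,0,2,6,4), (-16,0,3,3,6), (32,0,3,4,5), (-56,0,3,5,4), (16,0,3,6,3),
  (40,0,4,3,5), (-136,0,4,4,4), (88,0,4,5,3), (-8,0,4,6,2), (16,0,5,2,5), (-152,0,5,3,4), (192,0,5,4,3),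
  (-40,0,5,5,2), (-88,0,6,2,4), (224,0,6,3,3), (-88,0,6,4,2), (-32,0,7,1,4), (160,0,7,2,3), (-112,0,7,3,2),
  (72,0,8,1,3), (-88,0,8,2,2), (16,0,9,0,3), (-40,0,9,1,2), (-8,0,10,0,2), (8,1,1,4,6), (-8,1,1,5,5),
  (8,1,1,6,4), (24,1,2,3,6), (-24,1,2,4,5), (64,1,2,5,4), (-8,1,2,6,3), (16,1,3,2,6), (-32,1,3,3,5),
  (192,1,3,4,4), (-64,1,3,5,3), (-8,1,3,6,2), (-16,1,4,2,5), (280,1,4,3,4), (-208,1,4,4,3), (-32,1,4,5,2),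
  (8,1,4,6,1), (224,1,5,2,4), (-368,1,5,3,3), (-24,1,5,4,2), (40,1,5,5,1), (112,1,6,1,4), (-384,1,6,2,3),
  (56,1,6,3,2), (88,1,6,4,1), (32,1,7,0,4), (-224,1,7,1,3), (112,1,7,2,2), (112,1,7,3,1), (-56,1,8,0,3),
  (72,1,8,1,2), (88,1,8,2,1), (16,1,9,0,2), (40,1,9,1,1), (8,1,10,0,1), (-8,2,0,4,6), (8,2,0,5,5),
  (-8,2,0,6,4), (-40,2,1,3,6), (56,2,1,4,5), (-32,2,1,5,4), (-8,2,1,6,3), (-48,2,2,2,6), (136,2,2,3,5),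
  (-168,2,2,4,4), (-56,2,2,5,3), (24,2,2,6,2), (-16,2,3,1,6), (144,2,3,2,5), (-400,2,3,3,4), (-48,2,3,4,3),
  (136,2,3,5,2), (-8,2,3,6,1), (80,2,4,1,5), (-520,2,4,2,4), (320,2,4,3,3), (192,2,4,4,2), (-32,2,4,5,1),
  (-8,2,4,6,0), (32,2,5,0,5), (-384,2,5,1,4), (800,2,5,2,3), (-120,2,5,3,2), (-24,2,5,4,1), (-40,2,5,5,0),
  (-128,2,6,0,4), (672,2,6,1,3), (-488,2,6,2,2), (56,2,6,3,1), (-88,2,6,4,0), (192,2,7,0,3), (-384,2,7,1,2),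
  (112,2,7,2,1), (-112,2,7,3,0), (-96,2,8,0,2), (72,2,8,1,1), (-88,2,8,2,0), (16,2,9,0,1), (-40,2,9,1,0),
  (-8,2,10,0,0), (16,3,0,3,6), (-8,3,0,4,5), (-8,3,0,5,4), (16,3,0,6,3), (40,3,1,2,6), (-48,3,1,3,5),
  (-48,3,1,4,4), (80,3,1,5,3), (-8,3,1,6,2), (24,3,2,1,6), (-104,3,2,2,5), (272,3,2,4,3), (-56,3,2,5,2),
  (-8,3,2,6,1), (16,3,3,0,6), (-112,3,3,1,5), (320,3,3,2,4), (80,3,3,3,3), (-48,3,3,4,2), (-64,3,3,5,1),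
  (16,3,3,6,0), (-56,3,4,0,5), (480,3,4,1,4), (-720,3,4,2,3), (320,3,4,3,2), (-208,3,4,4,1), (88,3,4,5,0),
  (192,3,5,0,4), (-912,3,5,1,3), (800,3,5,2,2), (-368,3,5,3,1), (192,3,5,4,0), (-304,3,6,0,3), (672,3,6,1,2),
  (-384,3,6,2,1), (224,3,6,3,0), (192,3,7,0,2), (-224,3,7,1,1), (160,3,7,2,0), (-56,3,8,0,1), (72,3,8,1,0),
  (16,3,9,0,0), (-8,4,0,2,6), (-8,4,0,3,5), (24,4,0,4,4), (-8,4,0,5,3), (-8,4,0,6,2), (-8,4,1,1,6),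
  (-8,4,1,2,5), (88,4,1,3,4), (-48,4,1,4,3), (-32,4,1,5,2), (8,4,1,6,1), (-8,4,2,0,6), (24,4,2,1,5),
  (-8,4,2,2,4), (-168,4,2,4,2), (64,4,2,5,1), (-8,4,2,6,0), (16,4,3,0,5), (-192,4,3,1,4), (320,4,3,2,3),
  (-400,4,3,3,2), (192,4,3,4,1), (-56,4,3,5,0), (-96,4,4,0,4), (480,4,4,1,3), (-520,4,4,2,2), (280,4,4,3,1),
  (-136,4,4,4,0), (192,4,5,0,3), (-384,4,5,1,2), (224,4,5,2,1), (-152,4,5,3,0), (-128,4,6,0,2), (112,4,6,1,1),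
  (-88,4,6,2,0), (32,4,7,0,1), (-32,4,7,1,0), (-8,4,8,0,0), (8,5,0,2,5), (-8,5,0,3,4), (-8,5,0,4,3),
  (8,5,0,5,2), (8,5,1,1,5), (-8,5,1,2,4), (-48,5,1,3,3), (56,5,1,4,2), (-8,5,1,5,1), (8,5,2,0,5),
  (24,5,2,1,4), (-104,5,2,2,3), (136,5,2,3,2), (-24,5,2,4,1), (8,5,2,5,0), (16,5,3,0,4), (-112,5,3,1,3),
  (144,5,3,2,2), (-32,5,3,3,1), (32,5,3,4,0), (-56,5,4,0,3), (80,5,4,1,2), (-16,5,4,2,1), (40,5,4,3,0),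
  (32,5,5,0,2), (16,5,5,2,0), (-8,6,0,2,4), (16,6,0,3,3), (-8,6,0,4,2), (-8,6,1,1,4), (40,6,1,2,3),
  (-40,6,1,3,2), (8,6,1,4,1), (-8,6,2,0,4), (24,6,2,1,3), (-48,6,2,2,2), (24,6,2,3,1), (-8,6,2,4,0),
  (16,6,3,0,3), (-16,6,3,1,2), (16,6,3,2,1), (-16,6,3,3,0), (-8,6,4,0,2), (-8,6,4,2,0)]

def term (x y e z : R) (t : ℤ × ℕ × ℕ × ℕ × ℕ) : R :=
  (t.1 : R) * (x ^ t.2.1 * y ^ t.2.2.1 * e ^ t.2.2.2.1 * z ^ t.2.2.2.2)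

set_option maxRecDepth 10000 in
set_option maxHeartbeats 4000000 in
lemma q_expand (x y e z : R) :
    gA (projD x y e z) * gB (projD x y e z) - 4 * gC (projD x y e z) =
      term x y e z (-8, 0, 4, 2, 6) + term x y e z (-8, 0, 8, 0, 4)
        + term x y e z (-8, 2, 4, 0, 6) + (restL.map (term x y e z)).sum := by
  simp only [restL, List.map_cons, List.sum_cons, List.map_nil, List.sum_nil, term, gA, gB, gC,
    projD, Matrix.cons_val, Int.cast_neg, Int.cast_ofNat]
  ring

set_option maxRecDepth 10000 in
lemma restL_spec : ∀ t ∈ restL, t.2.1 + t.2.2.1 + t.2.2.2.1 + t.2.2.2.2 = 12 ∧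
    8 ≤ 2 * t.2.1 + t.2.2.1 + 2 * t.2.2.2.1 ∧ 6 ≤ t.2.1 + t.2.2.1 + t.2.2.2.1 ∧
    (0 < t.2.1 ∨ 8 < 2 * t.2.1 + t.2.2.1 + 2 * t.2.2.2.1 ∨ 6 < t.2.1 + t.2.2.1 + t.2.2.2.1) ∧
    (0 < t.2.1 ∨ 0 < t.2.2.2.1 ∨ 8 < 2 * t.2.1 + t.2.2.1 + 2 * t.2.2.2.1) ∧
    (0 < t.2.2.2.1 ∨ 8 < 2 * t.2.1 + t.2.2.1 + 2 * t.2.2.2.1 ∨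
      6 < t.2.1 + t.2.2.1 + t.2.2.2.1) := by
  unfold restL
  decide

section val

variable {K : Type*} [Field K] (v : AddValuation K (WithTop ℝ))

lemma v_int (n : ℤ) : 0 ≤ v (n : K) := by
  have hn : ∀ n : ℕ, 0 ≤ v (n : K) := by
    intro n
    induction n with
    | zero => simp
    | succ k ih =>
      push_cast
      exact le_trans (le_min ih (by simp)) (v.map_add _ _)
  obtain ⟨m, rfl | rfl⟩ := n.eq_nat_or_neg
  · simpa using hn m
  · simpa [v.map_neg] using hn m

lemma v_pow {x : K} {a : ℝ} (h : v x = (a : WithTop ℝ)) (n : ℕ) :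
    v (x ^ n) = ((n * a : ℝ) : WithTop ℝ) := by
  induction n with
  | zero => simp
  | succ k ih =>
    rw [pow_succ, v.map_mul, ih, h, ← WithTop.coe_add]
    congr 1; push_cast; ring

lemma v_term {x y e z : K} {X Y E Z w : ℝ} (hx : v x = (X : WithTop ℝ))
    (hy : v y = (Y : WithTop ℝ)) (he : v e = (E : WithTop ℝ)) (hz : v z = (Z : WithTop ℝ))
    (t : ℤ × ℕ × ℕ × ℕ × ℕ)
    (h : w < t.2.1 * X + t.2.2.1 * Y + t.2.2.2.1 * E + t.2.2.2.2 * Z) :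
    (w : WithTop ℝ) < v (term x y e z t) := by
  rw [term, v.map_mul, v.map_mul, v.map_mul, v.map_mul, v_pow v hx, v_pow v hy, v_pow v he,
    v_pow v hz, ← WithTop.coe_add, ← WithTop.coe_add, ← WithTop.coe_add]
  refine lt_of_lt_of_le (WithTop.coe_lt_coe.2 h) ?_
  exact le_add_of_nonneg_left (v_int v _)

lemma v_sum (f : (ℤ × ℕ × ℕ × ℕ × ℕ) → K) (w : ℝ) (L : List (ℤ × ℕ × ℕ × ℕ × ℕ))
    (h : ∀ t ∈ L, (w : WithTop ℝ) < v (f t)) : (w : WithTop ℝ) < v (L.map f).sum := by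
  induction L with
  | nil => simp
  | cons a L ih =>
    rw [List.map_cons, List.sum_cons]
    exact v.map_lt_add (h a (by simp)) (ih fun t ht => h t (by simp [ht]))

/-- same leading term -/
def Ap (x y : K) : Prop := ∃ m, 0 < v m ∧ x = y * (1 + m)

variable {v}

lemma Ap.refl (x : K) : Ap v x x := ⟨0, by simp, by simp⟩

lemma v_one_add {m : K} (h : 0 < v m) : v (1 + m) = 0 := by
  rw [v.map_add_eq_of_lt_left (by simpa using h)]; simp

lemma Ap.val {x y : K} (h : Ap v x y) : v x = v y := by
  obtain ⟨m, hm, rfl⟩ := h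
  rw [v.map_mul, v_one_add hm, add_zero]

lemma Ap.mul {x y x' y' : K} (h : Ap v x y) (h' : Ap v x' y') : Ap v (x * x') (y * y') := by
  obtain ⟨m, hm, rfl⟩ := h
  obtain ⟨n, hn, rfl⟩ := h'
  refine ⟨m * (1 + n) + n, v.map_lt_add ?_ hn, by ring⟩
  rw [v.map_mul, v_one_add hn, add_zero]; exact hm

lemma Ap.pow {x y : K} (h : Ap v x y) (n : ℕ) : Ap v (x ^ n) (y ^ n) := by
  induction n with
  | zero => simpa using Ap.refl (v := v) (1 : K)
  | succ k ih => rw [pow_succ, pow_succ]; exact ih.mul h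

lemma Ap.trans {x y z : K} (h : Ap v x y) (h' : Ap v y z) : Ap v x z := by
  obtain ⟨m, hm, rfl⟩ := h'
  obtain ⟨n, hn, rfl⟩ := h
  obtain ⟨k, hk, h⟩ := (Ap.mul (v := v) ⟨m, hm, rfl⟩ ⟨n, hn, rfl⟩ :
    Ap v ((1 * (1 + m)) * (1 * (1 + n))) (1 * 1))
  exact ⟨k, hk, by linear_combination z * h⟩

lemma Ap.of_sub {x y : K} {w : ℝ} (hy : v y = (w : WithTop ℝ)) (h : (w : WithTop ℝ) < v (x - y)) :
    Ap v x y := by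
  have hy0 : y ≠ 0 := by
    rintro rfl
    simp at hy
  refine ⟨(x - y) / y, ?_, by field_simp; ring⟩
  have h1 : v (x - y) = v ((x - y) / y) + w := by
    rw [← hy, ← v.map_mul]; congr 1; field_simp
  rw [h1] at h
  by_contra hc
  have := add_le_add_left (not_lt.1 hc) (w : WithTop ℝ)
  rw [zero_add] at this
  exact absurd h (not_lt.2 this)

lemma Ap.inv {x : K} (h : Ap v x 1) : Ap v x⁻¹ 1 := by
  obtain ⟨m, hm, rfl⟩ := h
  have h0 : (1 + m) ≠ 0 := by
    intro h
    have := v_one_add hm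
    rw [h] at this; simp at this
  have h1 : v (1 + m)⁻¹ = 0 := by
    have : v ((1 + m) * (1 + m)⁻¹) = 0 := by rw [mul_inv_cancel₀ h0]; simp
    rwa [v.map_mul, v_one_add hm, zero_add] at this
  refine ⟨-m * (1 + m)⁻¹, ?_, by field_simp; ring⟩
  rw [v.map_mul, h1, v.map_neg, add_zero]; exact hm

lemma Ap.fin {Q M : K} {w : ℝ} (h : Ap v Q (-8 * M)) (h2 : v (2 : K) = 0)
    (hM : v M = (w : WithTop ℝ)) : v Q = (w : WithTop ℝ) ∧ v (Q + 8 * M) > v Q := by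
  have h8 : v (-8 * M) = (w : WithTop ℝ) := by
    have : (-8 * M : K) = -(2 * 2 * 2 * M) := by ring
    rw [this, v.map_neg, v.map_mul, v.map_mul, v.map_mul, h2, hM]; simp
  have hQ : v Q = (w : WithTop ℝ) := h.val.trans h8
  refine ⟨hQ, ?_⟩
  rw [hQ]
  obtain ⟨m, hm, rfl⟩ := h
  have : -8 * M * (1 + m) + 8 * M = (-8 * M) * m := by ring
  rw [this, v.map_mul, h8]
  by_contra hc
  have hc := not_lt.1 hc
  by_cases hvm : v m = ⊤
  · rw [hvm, WithTop.add_top] at hc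
    exact absurd hc (by simp)
  · obtain ⟨r, hr⟩ := WithTop.ne_top_iff_exists.1 hvm
    rw [← hr] at hc hm
    have h1 : w + r ≤ w := by exact_mod_cast hc
    have h2 : 0 < r := by exact_mod_cast hm
    linarith

lemma pos3 {p q r : ℝ} (hp : 0 < p) (hq : 0 < q) (hr : 0 < r) (a b c : ℕ)
    (h : 0 < a ∨ 0 < b ∨ 0 < c) : 0 < a * p + b * q + c * r := by
  rcases h with h | h | h <;> have := (Nat.cast_pos (α := ℝ)).2 h <;> positivity

variable {x y e z : K} {X Y E Z : ℝ}

lemma q_case1 (hx : v x = (X : WithTop ℝ)) (hy : v y = (Y : WithTop ℝ))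
    (he : v e = (E : WithTop ℝ)) (hz : v z = (Z : WithTop ℝ)) (h2 : v (2 : K) = 0)
    (h1 : E < X) (h3 : Y < E) (h4 : E + Z < 2 * Y) :
    Ap v (gA (projD x y e z) * gB (projD x y e z) - 4 * gC (projD x y e z))
      (-8 * (z ^ 6 * e ^ 2 * y ^ 4)) := by
  have key : ∀ t : ℤ × ℕ × ℕ × ℕ × ℕ, t.2.1 + t.2.2.1 + t.2.2.2.1 + t.2.2.2.2 = 12 →
    8 ≤ 2 * t.2.1 + t.2.2.1 + 2 * t.2.2.2.1 → 6 ≤ t.2.1 + t.2.2.1 + t.2.2.2.1 →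
    (0 < t.2.1 ∨ 8 < 2 * t.2.1 + t.2.2.1 + 2 * t.2.2.2.1 ∨ 6 < t.2.1 + t.2.2.1 + t.2.2.2.1) →
    ((6 * Z + 2 * E + 4 * Y : ℝ) : WithTop ℝ) < v (term x y e z t) := by
    rintro ⟨n, a, c, b, d⟩ k1 k2 k3 k4
    apply v_term v hx hy he hz
    dsimp only at *
    obtain ⟨r, hr⟩ := Nat.exists_eq_add_of_le k2
    obtain ⟨s, hs⟩ := Nat.exists_eq_add_of_le k3
    have := pos3 (sub_pos.2 h1) (sub_pos.2 h3) (sub_pos.2 h4) a r s (by omega)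
    have hr' : (2 * a + c + 2 * b : ℝ) = 8 + r := by exact_mod_cast hr
    have hs' : (a + c + b : ℝ) = 6 + s := by exact_mod_cast hs
    have hd' : (a + c + b + d : ℝ) = 12 := by exact_mod_cast k1
    have hr2 : (r : ℝ) = 2 * a + c + 2 * b - 8 := by linarith
    have hs2 : (s : ℝ) = a + c + b - 6 := by linarith
    have hd2 : (d : ℝ) = 12 - a - c - b := by linarith
    rw [hr2, hs2] at this
    rw [hd2]
    linarith
  rw [q_expand]
  apply Ap.of_sub (w := 6 * Z + 2 * E + 4 * Y)
  · have : (-8 * (z ^ 6 * e ^ 2 * y ^ 4) : K) = -(2 * 2 * 2 * (z ^ 6 * e ^ 2 * y ^ 4)) := by ring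
    rw [this, v.map_neg]
    simp only [v.map_mul, h2, v_pow v hy, v_pow v he, v_pow v hz]
    simp only [← WithTop.coe_add, zero_add, Nat.cast_ofNat]
  · have : ∀ p q r : K, term x y e z (-8, 0, 4, 2, 6) + p + q + r - -8 * (z ^ 6 * e ^ 2 * y ^ 4)
        = p + q + r := by
      intro p q r
      simp only [term]; push_cast; ring
    rw [this]
    refine v.map_lt_add (v.map_lt_add ?_ ?_) (v_sum v _ _ _ fun t ht => ?_)
    · apply key <;> norm_num
    · apply key <;> norm_num
    · obtain ⟨k1, k2, k3, k4, k5, k6⟩ := restL_spec t ht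
      exact key t k1 k2 k3 k4

lemma q_case3 (hx : v x = (X : WithTop ℝ)) (hy : v y = (Y : WithTop ℝ))
    (he : v e = (E : WithTop ℝ)) (hz : v z = (Z : WithTop ℝ)) (h2 : v (2 : K) = 0)
    (h1 : X < E) (h3 : Y < X) (h4 : X + Z < 2 * Y) :
    Ap v (gA (projD x y e z) * gB (projD x y e z) - 4 * gC (projD x y e z))
      (-8 * (z ^ 6 * y ^ 4 * x ^ 2)) := by
  have key : ∀ t : ℤ × ℕ × ℕ × ℕ × ℕ, t.2.1 + t.2.2.1 + t.2.2.2.1 + t.2.2.2.2 = 12 →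
    8 ≤ 2 * t.2.1 + t.2.2.1 + 2 * t.2.2.2.1 → 6 ≤ t.2.1 + t.2.2.1 + t.2.2.2.1 →
    (0 < t.2.2.2.1 ∨ 8 < 2 * t.2.1 + t.2.2.1 + 2 * t.2.2.2.1 ∨
      6 < t.2.1 + t.2.2.1 + t.2.2.2.1) →
    ((6 * Z + 4 * Y + 2 * X : ℝ) : WithTop ℝ) < v (term x y e z t) := by
    rintro ⟨n, a, c, b, d⟩ k1 k2 k3 k4
    apply v_term v hx hy he hz
    dsimp only at *
    obtain ⟨r, hr⟩ := Nat.exists_eq_add_of_le k2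
    obtain ⟨s, hs⟩ := Nat.exists_eq_add_of_le k3
    have := pos3 (sub_pos.2 h1) (sub_pos.2 h3) (sub_pos.2 h4) b r s (by omega)
    have hr' : (2 * a + c + 2 * b : ℝ) = 8 + r := by exact_mod_cast hr
    have hs' : (a + c + b : ℝ) = 6 + s := by exact_mod_cast hs
    have hd' : (a + c + b + d : ℝ) = 12 := by exact_mod_cast k1
    have hr2 : (r : ℝ) = 2 * a + c + 2 * b - 8 := by linarith
    have hs2 : (s : ℝ) = a + c + b - 6 := by linarith
    have hd2 : (d : ℝ) = 12 - a - c - b := by linarith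
    rw [hr2, hs2] at this
    rw [hd2]
    linarith
  rw [q_expand]
  apply Ap.of_sub (w := 6 * Z + 4 * Y + 2 * X)
  · have : (-8 * (z ^ 6 * y ^ 4 * x ^ 2) : K) = -(2 * 2 * 2 * (z ^ 6 * y ^ 4 * x ^ 2)) := by ring
    rw [this, v.map_neg]
    simp only [v.map_mul, h2, v_pow v hy, v_pow v hx, v_pow v hz]
    simp only [← WithTop.coe_add, zero_add, Nat.cast_ofNat]
  · have : ∀ p q r : K, p + q + term x y e z (-8, 2, 4, 0, 6) + r - -8 * (z ^ 6 * y ^ 4 * x ^ 2)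
        = p + q + r := by
      intro p q r
      simp only [term]; push_cast; ring
    rw [this]
    refine v.map_lt_add (v.map_lt_add ?_ ?_) (v_sum v _ _ _ fun t ht => ?_)
    · apply key <;> norm_num
    · apply key <;> norm_num
    · obtain ⟨k1, k2, k3, k4, k5, k6⟩ := restL_spec t ht
      exact key t k1 k2 k3 k6

lemma q_case2 (hx : v x = (X : WithTop ℝ)) (hy : v y = (Y : WithTop ℝ))
    (he : v e = (E : WithTop ℝ)) (hz : v z = (Z : WithTop ℝ)) (h2 : v (2 : K) = 0)
    (h1 : 2 * Y < X + Z) (h3 : 2 * Y < E + Z) (h4 : Z < Y) :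
    Ap v (gA (projD x y e z) * gB (projD x y e z) - 4 * gC (projD x y e z))
      (-8 * (z ^ 4 * y ^ 8)) := by
  have key : ∀ t : ℤ × ℕ × ℕ × ℕ × ℕ, t.2.1 + t.2.2.1 + t.2.2.2.1 + t.2.2.2.2 = 12 →
    8 ≤ 2 * t.2.1 + t.2.2.1 + 2 * t.2.2.2.1 →
    (0 < t.2.1 ∨ 0 < t.2.2.2.1 ∨ 8 < 2 * t.2.1 + t.2.2.1 + 2 * t.2.2.2.1) →
    ((4 * Z + 8 * Y : ℝ) : WithTop ℝ) < v (term x y e z t) := by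
    rintro ⟨n, a, c, b, d⟩ k1 k2 k4
    apply v_term v hx hy he hz
    dsimp only at *
    obtain ⟨r, hr⟩ := Nat.exists_eq_add_of_le k2
    have := pos3 (sub_pos.2 h1) (sub_pos.2 h3) (sub_pos.2 h4) a b r (by omega)
    have hr' : (2 * a + c + 2 * b : ℝ) = 8 + r := by exact_mod_cast hr
    have hd' : (a + c + b + d : ℝ) = 12 := by exact_mod_cast k1
    have hr2 : (r : ℝ) = 2 * a + c + 2 * b - 8 := by linarith
    have hd2 : (d : ℝ) = 12 - a - c - b := by linarith
    rw [hr2] at this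
    rw [hd2]
    linarith
  rw [q_expand]
  apply Ap.of_sub (w := 4 * Z + 8 * Y)
  · have : (-8 * (z ^ 4 * y ^ 8) : K) = -(2 * 2 * 2 * (z ^ 4 * y ^ 8)) := by ring
    rw [this, v.map_neg]
    simp only [v.map_mul, h2, v_pow v hy, v_pow v hz]
    simp only [← WithTop.coe_add, zero_add, Nat.cast_ofNat]
  · have : ∀ p q r : K, p + term x y e z (-8, 0, 8, 0, 4) + q + r - -8 * (z ^ 4 * y ^ 8)
        = p + q + r := by
      intro p q r
      simp only [term]; push_cast; ring
    rw [this]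
    refine v.map_lt_add (v.map_lt_add ?_ ?_) (v_sum v _ _ _ fun t ht => ?_)
    · apply key <;> norm_num
    · apply key <;> norm_num
    · obtain ⟨k1, k2, k3, k4, k5, k6⟩ := restL_spec t ht
      exact key t k1 k2 k5

lemma Q_scale (a₁ a₂ a₃ a₄ a₅ a₆ u₂ u₃ u₄ u₅ x y e z : K)
    (h2 : (a₆ - a₁) * u₂ = a₆ - a₂) (h3 : (a₆ - a₁) * u₃ = a₆ - a₃)
    (h4 : (a₆ - a₁) * u₄ = a₆ - a₄) (h5 : (a₆ - a₁) * u₅ = a₆ - a₅) (h6 : a₆ - a₁ ≠ 0)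
    (hx : x * u₂ = a₂ - a₁) (hy : y * u₃ = a₃ - a₁) (he : (y + e) * u₄ = a₄ - a₁)
    (hz : z * u₅ = a₅ - a₁) :
    igusaA a₁ a₂ a₃ a₄ a₅ a₆ * igusaB a₁ a₂ a₃ a₄ a₅ a₆ - 4 * igusaC a₁ a₂ a₃ a₄ a₅ a₆ =
      (u₂ * u₃ * u₄ * u₅ * (a₆ - a₁)) ^ 6 *
      (gA (projD x y e z) * gB (projD x y e z) - 4 * gC (projD x y e z)) := by
  let a : Fin 6 → K := ![a₁, a₂, a₃, a₄, a₅, a₆]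
  let r : Fin 6 → K := ![1, u₂, u₃, u₄, u₅, a₆ - a₁]
  let p : Fin 6 → K := ![0, x, y, y + e, z, 1]
  let w : Fin 6 → K := ![1, 1, 1, 1, 1, 0]
  have hp : ∀ i, r i * p i = a i - a₁ := by
    intro i; fin_cases i <;> simp [r, p, a] <;> grind
  have hw : ∀ i, (a₆ - a₁) * (r i * w i) = a₆ - a i := by
    intro i; fin_cases i <;> simp [r, w, a] <;> grind
  have hD : (fun i j => (a i - a j) ^ 2) =
      fun i j => (r i ^ 2) * (r j ^ 2) * projD x y e z i j := by
    funext i j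
    have : a i - a j = r i * r j * (p i * w j - p j * w i) := by
      apply mul_left_cancel₀ h6
      have e1 := hp i
      have e2 := hp j
      have e3 := hw i
      have e4 := hw j
      have : (a₆ - a₁) * (r i * r j * (p i * w j - p j * w i)) =
        (r i * p i) * ((a₆ - a₁) * (r j * w j)) - (r j * p j) * ((a₆ - a₁) * (r i * w i)) := by
        ring
      rw [this, e1, e2, e3, e4]; ring
    rw [this, mul_pow, mul_pow]; rfl
  have hA : igusaA a₁ a₂ a₃ a₄ a₅ a₆ = _ := igusaA_eq a
  have hB : igusaB a₁ a₂ a₃ a₄ a₅ a₆ = _ := igusaB_eq a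
  have hC : igusaC a₁ a₂ a₃ a₄ a₅ a₆ = _ := igusaC_eq a
  rw [hA, hB, hC, hD, gA_scale _ (fun i => r i ^ 2), gB_scale _ (fun i => r i ^ 2),
    gC_scale _ (fun i => r i ^ 2)]
  have r0 : r 0 = 1 := rfl
  have r1 : r 1 = u₂ := rfl
  have r2 : r 2 = u₃ := rfl
  have r3 : r 3 = u₄ := rfl
  have r4 : r 4 = u₅ := rfl
  have r5 : r 5 = a₆ - a₁ := rfl
  simp only [r0, r1, r2, r3, r4, r5]
  ring

end val

/-- **Piecewise valuation of `Q₄ = A·B − 4C` on the theta cone.**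
With `ω₁ < ω₂ < ω₃ = ω₄ < ω₅ < ω₆`, `d₃₄ = −val (α₃ − α₄) < ω₃` and `val 2 = 0`,
the valuation of `A·B − 4C` is given piecewise on the three subdivided pieces of the
theta cone, with the stated initial terms. -/
theorem Q4_piecewise_valuation_theta_cone
    {K : Type*} [Field K] (val : K → WithTop ℝ)
    (hval0 : ∀ x : K, val x = ⊤ ↔ x = 0)
    (hvalmul : ∀ x y : K, val (x * y) = val x + val y)
    (hvaladd : ∀ x y : K, min (val x) (val y) ≤ val (x + y))
    (a₁ a₂ a₃ a₄ a₅ a₆ : K)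
    (hdist : List.Pairwise (· ≠ ·) [a₁, a₂, a₃, a₄, a₅, a₆])
    (hne : ∀ a ∈ [a₁, a₂, a₃, a₄, a₅, a₆], a ≠ 0)
    (ω₁ ω₂ ω₃ ω₄ ω₅ ω₆ d₃₄ : ℝ)
    (hω₁ : val a₁ = ((-ω₁ : ℝ) : WithTop ℝ)) (hω₂ : val a₂ = ((-ω₂ : ℝ) : WithTop ℝ))
    (hω₃ : val a₃ = ((-ω₃ : ℝ) : WithTop ℝ)) (hω₄ : val a₄ = ((-ω₄ : ℝ) : WithTop ℝ))
    (hω₅ : val a₅ = ((-ω₅ : ℝ) : WithTop ℝ)) (hω₆ : val a₆ = ((-ω₆ : ℝ) : WithTop ℝ))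
    (h₁₂ : ω₁ < ω₂) (h₂₃ : ω₂ < ω₃) (h₃₄ : ω₃ = ω₄) (h₄₅ : ω₄ < ω₅) (h₅₆ : ω₅ < ω₆)
    (hd₃₄ : val (a₃ - a₄) = ((-d₃₄ : ℝ) : WithTop ℝ)) (hd : d₃₄ < ω₃)
    (h2 : val (2 : K) = (0 : WithTop ℝ)) :
    let A := igusaA a₁ a₂ a₃ a₄ a₅ a₆
    let B := igusaB a₁ a₂ a₃ a₄ a₅ a₆
    let C := igusaC a₁ a₂ a₃ a₄ a₅ a₆
    let Q := A * B - 4 * C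
    (ω₂ < d₃₄ → 2 * ω₃ < ω₅ + d₃₄ →
      val Q = ((-(6 * ω₆ + 6 * ω₅ + 2 * d₃₄ + 4 * ω₃) : ℝ) : WithTop ℝ) ∧
      val (Q + 8 * (a₆ ^ 6 * a₅ ^ 6 * (a₄ - a₃) ^ 2 * a₃ ^ 4)) > val Q) ∧
    (ω₅ + ω₂ < 2 * ω₃ → ω₅ + d₃₄ < 2 * ω₃ →
      val Q = ((-(6 * ω₆ + 4 * ω₅ + 8 * ω₃) : ℝ) : WithTop ℝ) ∧
      val (Q + 8 * (a₆ ^ 6 * a₅ ^ 4 * a₃ ^ 8)) > val Q) ∧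
    (d₃₄ < ω₂ → 2 * ω₃ < ω₅ + ω₂ →
      val Q = ((-(6 * ω₆ + 6 * ω₅ + 4 * ω₃ + 2 * ω₂) : ℝ) : WithTop ℝ) ∧
      val (Q + 8 * (a₆ ^ 6 * a₅ ^ 6 * a₃ ^ 4 * a₂ ^ 2)) > val Q) := by
  have hv1 : val 1 = 0 := by
    have h := hvalmul 1 1
    rw [mul_one] at h
    have hne : val 1 ≠ ⊤ := fun h => one_ne_zero ((hval0 1).1 h)
    obtain ⟨r, hr⟩ := WithTop.ne_top_iff_exists.1 hne
    rw [← hr] at h ⊢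
    have h' : r = r + r := by exact_mod_cast h
    have : r = 0 := by linarith
    rw [this]; rfl
  obtain ⟨v, hv⟩ : ∃ v : AddValuation K (WithTop ℝ), ∀ x, v x = val x :=
    ⟨AddValuation.of val ((hval0 0).2 rfl) hv1 hvaladd hvalmul, fun x => rfl⟩
  simp only [← hv] at *
  subst h₃₄
  have b_of : ∀ (a : K) (o : ℝ), v a = ((-o : ℝ) : WithTop ℝ) → ω₁ < o → Ap v (a - a₁) a := by
    intro a o ha ho
    apply Ap.of_sub ha
    have : a - a₁ - a = -a₁ := by ring
    rw [this, v.map_neg, hω₁]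
    exact WithTop.coe_lt_coe.2 (by linarith)
  have hb2 := b_of a₂ ω₂ hω₂ h₁₂
  have hb3 := b_of a₃ ω₃ hω₃ (by linarith)
  have hb4 := b_of a₄ ω₃ hω₄ (by linarith)
  have hb5 := b_of a₅ ω₅ hω₅ (by linarith)
  have hb6 := b_of a₆ ω₆ hω₆ (by linarith)
  have h60 : a₆ - a₁ ≠ 0 := by
    intro h
    have := hb6.val
    rw [h, hω₆, v.map_zero] at this
    exact WithTop.coe_ne_top this.symm
  have u_of : ∀ (a : K) (o : ℝ), v a = ((-o : ℝ) : WithTop ℝ) → o < ω₆ →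
      Ap v ((a₆ - a) / (a₆ - a₁)) 1 := by
    intro a o ha ho
    have h1 : Ap v (a₆ - a) a₆ := by
      apply Ap.of_sub hω₆
      have : a₆ - a - a₆ = -a := by ring
      rw [this, v.map_neg, ha]
      exact WithTop.coe_lt_coe.2 (by linarith)
    obtain ⟨m, hm, e1⟩ := hb6
    obtain ⟨n, hn, e2⟩ := h1
    have h6 : a₆ ≠ 0 := hne a₆ (by simp)
    have hi : Ap v (1 + m)⁻¹ 1 := Ap.inv ⟨m, hm, by ring⟩
    have : (a₆ - a) / (a₆ - a₁) = (1 + n) * (1 + m)⁻¹ := by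
      rw [e1, e2, mul_div_mul_left _ _ h6, div_eq_mul_inv]
    rw [this]
    have := Ap.mul (v := v) (⟨n, hn, by ring⟩ : Ap v (1 + n) 1) hi
    simpa using this
  have hu2 := u_of a₂ ω₂ hω₂ (by linarith)
  have hu3 := u_of a₃ ω₃ hω₃ (by linarith)
  have hu4 := u_of a₄ ω₃ hω₄ (by linarith)
  have hu5 := u_of a₅ ω₅ hω₅ (by linarith)
  have ne_of : ∀ u : K, Ap v u 1 → u ≠ 0 := by
    rintro u hu rfl
    have := hu.val
    simp at this
  obtain ⟨u₂, eu2⟩ : ∃ u, u = (a₆ - a₂) / (a₆ - a₁) := ⟨_, rfl⟩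
  obtain ⟨u₃, eu3⟩ : ∃ u, u = (a₆ - a₃) / (a₆ - a₁) := ⟨_, rfl⟩
  obtain ⟨u₄, eu4⟩ : ∃ u, u = (a₆ - a₄) / (a₆ - a₁) := ⟨_, rfl⟩
  obtain ⟨u₅, eu5⟩ : ∃ u, u = (a₆ - a₅) / (a₆ - a₁) := ⟨_, rfl⟩
  rw [← eu2] at hu2
  rw [← eu3] at hu3
  rw [← eu4] at hu4
  rw [← eu5] at hu5
  have n2 := ne_of _ hu2
  have n3 := ne_of _ hu3
  have n4 := ne_of _ hu4
  have n5 := ne_of _ hu5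
  have k2 : (a₆ - a₁) * u₂ = a₆ - a₂ := by rw [eu2]; field_simp
  have k3 : (a₆ - a₁) * u₃ = a₆ - a₃ := by rw [eu3]; field_simp
  have k4 : (a₆ - a₁) * u₄ = a₆ - a₄ := by rw [eu4]; field_simp
  have k5 : (a₆ - a₁) * u₅ = a₆ - a₅ := by rw [eu5]; field_simp
  have hQ := Q_scale a₁ a₂ a₃ a₄ a₅ a₆ u₂ u₃ u₄ u₅ ((a₂ - a₁) * u₂⁻¹) ((a₃ - a₁) * u₃⁻¹)
    ((a₄ - a₃) * (u₃⁻¹ * u₄⁻¹)) ((a₅ - a₁) * u₅⁻¹) k2 k3 k4 k5 h60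
    (by field_simp) (by field_simp)
    (by
      field_simp
      apply mul_left_cancel₀ h60
      linear_combination (a₃ - a₁) * k4 - (a₄ - a₁) * k3) (by field_simp)
  have hx : Ap v ((a₂ - a₁) * u₂⁻¹) a₂ := by simpa using hb2.mul hu2.inv
  have hy : Ap v ((a₃ - a₁) * u₃⁻¹) a₃ := by simpa using hb3.mul hu3.inv
  have hz : Ap v ((a₅ - a₁) * u₅⁻¹) a₅ := by simpa using hb5.mul hu5.inv
  have he : Ap v ((a₄ - a₃) * (u₃⁻¹ * u₄⁻¹)) (a₄ - a₃) := by
    simpa using (Ap.refl (v := v) (a₄ - a₃)).mul (hu3.inv.mul hu4.inv)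
  have hd43 : v (a₄ - a₃) = ((-d₃₄ : ℝ) : WithTop ℝ) := by
    rw [← hd₃₄, ← v.map_neg, neg_sub]
  have hU : Ap v ((u₂ * u₃ * u₄ * u₅ * (a₆ - a₁)) ^ 6) (a₆ ^ 6) := by
    simpa using ((((hu2.mul hu3).mul hu4).mul hu5).mul hb6).pow 6
  generalize (a₂ - a₁) * u₂⁻¹ = x at *
  generalize (a₃ - a₁) * u₃⁻¹ = y at *
  generalize (a₅ - a₁) * u₅⁻¹ = z at *
  generalize (a₄ - a₃) * (u₃⁻¹ * u₄⁻¹) = e at *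
  have vx := hx.val.trans hω₂
  have vy := hy.val.trans hω₃
  have vz := hz.val.trans hω₅
  have ve := he.val.trans hd43
  have h8 := Ap.refl (v := v) (-8 : K)
  refine ⟨fun i1 i2 => ?_, fun i1 i2 => ?_, fun i1 i2 => ?_⟩
  · refine Ap.fin (v := v) ?_ h2 ?_
    · rw [hQ]
      have h := hU.mul ((q_case1 vx vy ve vz h2 (by linarith) (by linarith) (by linarith)).trans
        (h8.mul (((hz.pow 6).mul (he.pow 2)).mul (hy.pow 4))))
      convert h using 1
      ring
    · simp only [v.map_mul, v_pow v hω₆, v_pow v hω₅, v_pow v hd43, v_pow v hω₃,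
        ← WithTop.coe_add]
      congr 1; push_cast; ring
  · refine Ap.fin (v := v) ?_ h2 ?_
    · rw [hQ]
      have h := hU.mul ((q_case2 vx vy ve vz h2 (by linarith) (by linarith) (by linarith)).trans
        (h8.mul ((hz.pow 4).mul (hy.pow 8))))
      convert h using 1
      ring
    · simp only [v.map_mul, v_pow v hω₆, v_pow v hω₅, v_pow v hω₃, ← WithTop.coe_add]
      congr 1; push_cast; ring
  · refine Ap.fin (v := v) ?_ h2 ?_
    · rw [hQ]
      have h := hU.mul ((q_case3 vx vy ve vz h2 (by linarith) (by linarith) (by linarith)).trans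
        (h8.mul (((hz.pow 6).mul (hy.pow 4)).mul (hx.pow 2))))
      convert h using 1
      ring
    · simp only [v.map_mul, v_pow v hω₆, v_pow v hω₅, v_pow v hω₂, v_pow v hω₃,
        ← WithTop.coe_add]
      congr 1; push_cast; ring

end Genus2Igusa
end

section
/- Tropicalization of the new Igusa invariant j₄ = j₂ − 4j₃: (i) Assume α₁,…,α₆ ∈ K are pairwise distinct and nonzero with ω_i := −val(α_i) satisfying ω₁ < ω₂ < ω₃ < ω₄ < ω₅ < ω₆, and val(6) = 0; then, with L₀ = (ω₄ − ω₃)/2, L₁ = 2(ω₅ − ω₄), L₂ = 2(ω₃ − ω₂), one has −val(A²(A·B − 4C)/D) = L₁ + 8L₀ + L₂ = −val(A²C/D). (ii) Assume instead ω₁ < ω₂ < ω₃ = ω₄ < ω₅ < ω₆ and d₃₄ := −val(α₃ − α₄) < ω₃, and val(2) = 0; set L₀ = 2(ω₃ − d₃₄), L₁ = 2(ω₅ − ω₃), L₂ = 2(ω₃ − ω₂), and assume the minimum of {L₀, L₁, L₂} is attained for exactly one index; then −val(A²(A·B − 4C)/D) = L₀ + L₁ + L₂ − min{L₀, L₁,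 L₂}. -/
namespace Genus2Igusa

variable {R : Type*} [CommRing R]

/-- product of six factors -/
def pr6 (a b c d e f : R) : R := a * b * c * (d * e * f)

/-- permanent of a 3 by 3 matrix -/
def per3 (a b c d e f g h i : R) : R :=
  a * e * i + a * f * h + b * d * i + b * f * g + c * d * h + c * e * g

def hA (q d12 d13 d14 d15 d16 d23 d24 d25 d26 d34 d35 d36 d45 d46 d56 : R) : R :=
    (q * d12) * d34 * d56 + (q * d12) * d35 * d46 + (q * d12) * d36 * d45 +
    (q * d13) * d24 * d56 + (q * d13) * d25 * d46 + (q * d13) * d26 * d45 +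
    d14 * (q * d23) * d56 + d14 * d25 * d36 + d14 * d26 * d35 +
    d15 * (q * d23) * d46 + d15 * d24 * d36 + d15 * d26 * d34 +
    d16 * (q * d23) * d45 + d16 * d24 * d35 + d16 * d25 * d34

def hB (q d12 d13 d14 d15 d16 d23 d24 d25 d26 d34 d35 d36 d45 d46 d56 : R) : R :=
    q ^ 2 * pr6 d12 d23 d13 d45 d56 d46 + pr6 d12 d24 d14 d35 d56 d36 +
    pr6 d12 d25 d15 d34 d46 d36 + pr6 d12 d26 d16 d34 d45 d35 +
    pr6 d13 d34 d14 d25 d56 d26 + pr6 d13 d35 d15 d24 d46 d26 +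
    pr6 d13 d36 d16 d24 d45 d25 + pr6 d14 d45 d15 d23 d36 d26 +
    pr6 d14 d46 d16 d23 d35 d25 + pr6 d15 d56 d16 d23 d34 d24

def hC (q d12 d13 d14 d15 d16 d23 d24 d25 d26 d34 d35 d36 d45 d46 d56 : R) : R :=
    q ^ 2 * pr6 d12 d23 d13 d45 d56 d46 * per3 d14 d15 d16 d24 d25 d26 d34 d35 d36 +
    pr6 d12 d24 d14 d35 d56 d36 * per3 (q * d13) d15 d16 (q * d23) d25 d26 d34 d45 d46 +
    pr6 d12 d25 d15 d34 d46 d36 * per3 (q * d13) d14 d16 (q * d23) d24 d26 d35 d45 d56 +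
    pr6 d12 d26 d16 d34 d45 d35 * per3 (q * d13) d14 d15 (q * d23) d24 d25 d36 d46 d56 +
    pr6 d13 d34 d14 d25 d56 d26 * per3 (q * d12) d15 d16 (q * d23) d35 d36 d24 d45 d46 +
    pr6 d13 d35 d15 d24 d46 d26 * per3 (q * d12) d14 d16 (q * d23) d34 d36 d25 d45 d56 +
    pr6 d13 d36 d16 d24 d45 d25 * per3 (q * d12) d14 d15 (q * d23) d34 d35 d26 d46 d56 +
    pr6 d14 d45 d15 d23 d36 d26 * per3 (q * d12) (q * d13) d16 d24 d34 d46 d25 d35 d56 +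
    pr6 d14 d46 d16 d23 d35 d25 * per3 (q * d12) (q * d13) d15 d24 d34 d45 d26 d36 d56 +
    pr6 d15 d56 d16 d23 d34 d24 * per3 (q * d12) (q * d13) d14 d25 d35 d45 d26 d36 d46

def hE (q d12 d13 d14 d15 d16 d23 d24 d25 d26 d34 d35 d36 d45 d46 d56 : R) : R :=
  hA q d12 d13 d14 d15 d16 d23 d24 d25 d26 d34 d35 d36 d45 d46 d56 * hB q d12 d13 d14 d15 d16 d23 d24 d25 d26 d34 d35 d36 d45 d46 d56 -
    4 * hC q d12 d13 d14 d15 d16 d23 d24 d25 d26 d34 d35 d36 d45 d46 d56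

theorem dlt_comm (x y : R) : dlt x y = dlt y x := by unfold dlt; ring

theorem scale (a1 a2 a3 a4 a5 a6 l m n q d12 d13 d14 d15 d16 d23 d24 d25 d26 d34 d35 d36 d45 d46 d56 : R)
    (h12 : dlt a1 a2 = l * l * (q * d12))
    (h13 : dlt a1 a3 = l * l * (q * d13))
    (h14 : dlt a1 a4 = l * l * d14)
    (h15 : dlt a1 a5 = l * m * d15)
    (h16 : dlt a1 a6 = l * n * d16)
    (h23 : dlt a2 a3 = l * l * (q * d23))
    (h24 : dlt a2 a4 = l * l * d24)
    (h25 : dlt a2 a5 = l * m * d25)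
    (h26 : dlt a2 a6 = l * n * d26)
    (h34 : dlt a3 a4 = l * l * d34)
    (h35 : dlt a3 a5 = l * m * d35)
    (h36 : dlt a3 a6 = l * n * d36)
    (h45 : dlt a4 a5 = l * m * d45)
    (h46 : dlt a4 a6 = l * n * d46)
    (h56 : dlt a5 a6 = m * n * d56)
   :
    igusaA a1 a2 a3 a4 a5 a6 = (l ^ 4 * m * n) * hA q d12 d13 d14 d15 d16 d23 d24 d25 d26 d34 d35 d36 d45 d46 d56 ∧
    igusaB a1 a2 a3 a4 a5 a6 = (l ^ 4 * m * n) ^ 2 * q * hB q d12 d13 d14 d15 d16 d23 d24 d25 d26 d34 d35 d36 d45 d46 d56 ∧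
    igusaC a1 a2 a3 a4 a5 a6 = (l ^ 4 * m * n) ^ 3 * q * hC q d12 d13 d14 d15 d16 d23 d24 d25 d26 d34 d35 d36 d45 d46 d56 := by
  refine ⟨?_, ?_, ?_⟩
  · simp only [igusaA, hA, h12, h13, h14, h15, h16, h23, h24, h25, h26, h34, h35, h36, h45, h46, h56]
    ring
  · simp only [igusaB, tri, hB, pr6, dlt_comm a3 a1, dlt_comm a4 a1, dlt_comm a5 a1, dlt_comm a6 a1,
      dlt_comm a4 a2, dlt_comm a5 a2, dlt_comm a6 a2, dlt_comm a5 a3, dlt_comm a6 a3, dlt_comm a6 a4,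
      h12, h13, h14, h15, h16, h23, h24, h25, h26, h34, h35, h36, h45, h46, h56]
    ring
  · simp only [igusaC, tri, mtch, hC, pr6, per3, dlt_comm a3 a1, dlt_comm a4 a1, dlt_comm a5 a1, dlt_comm a6 a1, dlt_comm a3 a2, dlt_comm a4 a2, dlt_comm a5 a2, dlt_comm a6 a2, dlt_comm a4 a3, dlt_comm a5 a3, dlt_comm a6 a3, dlt_comm a5 a4, dlt_comm a6 a4, dlt_comm a6 a5,
      h12, h13, h14, h15, h16, h23, h24, h25, h26, h34, h35, h36, h45, h46, h56]
    ring

/-- theta cone, normalised -/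
def tA (s x y z t : R) : R :=
  hA 1 (x ^ 2 * (1 - s) ^ 2) ((1 - s * x) ^ 2) ((1 - z - s * x) ^ 2) ((1 - s * x * y) ^ 2) ((1 - s * x * y * t) ^ 2)
      ((1 - x) ^ 2) ((1 - z - x) ^ 2) ((1 - x * y) ^ 2) ((1 - x * y * t) ^ 2) (z ^ 2)
      ((1 - y) ^ 2) ((1 - y * t) ^ 2) ((1 - (1 - z) * y) ^ 2) ((1 - (1 - z) * y * t) ^ 2) (y ^ 2 * (1 - t) ^ 2)

def tE (s x y z t : R) : R :=
  hE 1 (x ^ 2 * (1 - s) ^ 2) ((1 - s * x) ^ 2) ((1 - z - s * x) ^ 2) ((1 - s * x * y) ^ 2) ((1 - s * x * y * t) ^ 2)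
      ((1 - x) ^ 2) ((1 - z - x) ^ 2) ((1 - x * y) ^ 2) ((1 - x * y * t) ^ 2) (z ^ 2)
      ((1 - y) ^ 2) ((1 - y * t) ^ 2) ((1 - (1 - z) * y) ^ 2) ((1 - (1 - z) * y * t) ^ 2) (y ^ 2 * (1 - t) ^ 2)

/-- dumbbell cone, normalised -/
def bA (r1 r2 r3 r4 r5 : R) : R :=
  hA (r3 ^ 2) (r2 ^ 2 * (1 - r1) ^ 2) ((1 - r1 * r2) ^ 2) ((1 - r1 * r2 * r3) ^ 2) ((1 - r1 * r2 * r3 * r4) ^ 2) ((1 - r1 * r2 * r3 * r4 * r5) ^ 2)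
      ((1 - r2) ^ 2) ((1 - r2 * r3) ^ 2) ((1 - r2 * r3 * r4) ^ 2) ((1 - r2 * r3 * r4 * r5) ^ 2) ((1 - r3) ^ 2)
      ((1 - r3 * r4) ^ 2) ((1 - r3 * r4 * r5) ^ 2) ((1 - r4) ^ 2) ((1 - r4 * r5) ^ 2) (r4 ^ 2 * (1 - r5) ^ 2)

def bC (r1 r2 r3 r4 r5 : R) : R :=
  hC (r3 ^ 2) (r2 ^ 2 * (1 - r1) ^ 2) ((1 - r1 * r2) ^ 2) ((1 - r1 * r2 * r3) ^ 2) ((1 - r1 * r2 * r3 * r4) ^ 2) ((1 - r1 * r2 * r3 * r4 * r5) ^ 2)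
      ((1 - r2) ^ 2) ((1 - r2 * r3) ^ 2) ((1 - r2 * r3 * r4) ^ 2) ((1 - r2 * r3 * r4 * r5) ^ 2) ((1 - r3) ^ 2)
      ((1 - r3 * r4) ^ 2) ((1 - r3 * r4 * r5) ^ 2) ((1 - r4) ^ 2) ((1 - r4 * r5) ^ 2) (r4 ^ 2 * (1 - r5) ^ 2)

def bE (r1 r2 r3 r4 r5 : R) : R :=
  hE (r3 ^ 2) (r2 ^ 2 * (1 - r1) ^ 2) ((1 - r1 * r2) ^ 2) ((1 - r1 * r2 * r3) ^ 2) ((1 - r1 * r2 * r3 * r4) ^ 2) ((1 - r1 * r2 * r3 * r4 * r5) ^ 2)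
      ((1 - r2) ^ 2) ((1 - r2 * r3) ^ 2) ((1 - r2 * r3 * r4) ^ 2) ((1 - r2 * r3 * r4 * r5) ^ 2) ((1 - r3) ^ 2)
      ((1 - r3 * r4) ^ 2) ((1 - r3 * r4 * r5) ^ 2) ((1 - r4) ^ 2) ((1 - r4 * r5) ^ 2) (r4 ^ 2 * (1 - r5) ^ 2)

section maps
variable {S : Type*} [CommRing S] (f : R →+* S)

theorem map_bA (r1 r2 r3 r4 r5 : R) :
    f (bA r1 r2 r3 r4 r5) = bA (f r1) (f r2) (f r3) (f r4) (f r5) := by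
  simp only [bA, hA, map_add, map_mul, map_sub, map_pow, map_one]

theorem map_bC (r1 r2 r3 r4 r5 : R) :
    f (bC r1 r2 r3 r4 r5) = bC (f r1) (f r2) (f r3) (f r4) (f r5) := by
  simp only [bC, hC, pr6, per3, map_add, map_mul, map_sub, map_pow, map_one]

theorem map_bE (r1 r2 r3 r4 r5 : R) :
    f (bE r1 r2 r3 r4 r5) = bE (f r1) (f r2) (f r3) (f r4) (f r5) := by
  simp only [bE, hE, hA, hB, hC, pr6, per3, map_add, map_mul, map_sub, map_pow, map_one, map_ofNat]

theorem map_tA (s x y z t : R) :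
    f (tA s x y z t) = tA (f s) (f x) (f y) (f z) (f t) := by
  simp only [tA, hA, map_add, map_mul, map_sub, map_pow, map_one]

theorem map_tE (s x y z t : R) :
    f (tE s x y z t) = tE (f s) (f x) (f y) (f z) (f t) := by
  simp only [tE, hE, hA, hB, hC, pr6, per3, map_add, map_mul, map_sub, map_pow, map_one, map_ofNat]

end maps

theorem bA_zero : bA (0 : R) 0 0 0 0 = 6 := by
  simp [bA, hA]; norm_num

theorem bC_zero : bC (0 : R) 0 0 0 0 = 8 := by
  simp [bC, hC, pr6, per3]; norm_num

theorem bE_zero : bE (0 : R) 0 0 0 0 = -8 := by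
  simp [bE, hE, hA, hB, hC, pr6, per3]; norm_num

theorem tA_zero (s t : R) : tA s 0 0 0 t = 8 := by
  simp [tA, hA]; norm_num

theorem tE_zero (s t : R) : tE s 0 0 0 t = 0 := by
  simp [tE, hE, hA, hB, hC, pr6, per3]; norm_num

theorem tE_x (s x t : R) :
    tE s x 0 0 t = -8 * ((1 - s) * (1 - x) * (1 - s * x)) ^ 2 * x ^ 2 := by
  simp [tE, hE, hA, hB, hC, pr6, per3]; ring

theorem tE_y (s y t : R) :
    tE s 0 y 0 t = -8 * ((1 - t) * (1 - y) * (1 - y * t)) ^ 2 * y ^ 2 := by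
  simp [tE, hE, hA, hB, hC, pr6, per3]; ring

theorem tE_z (s z t : R) :
    tE s 0 0 z t = -8 * (1 - z) ^ 2 * z ^ 2 := by
  simp [tE, hE, hA, hB, hC, pr6, per3]; ring

theorem poly_split (x y z : R) (f : MvPolynomial (Fin 3) R) :
    ∃ f0 a b c p q r : R,
      MvPolynomial.eval ![0, 0, 0] f = f0 ∧
      MvPolynomial.eval ![x, 0, 0] f = f0 + x * a ∧
      MvPolynomial.eval ![0, y, 0] f = f0 + y * b ∧
      MvPolynomial.eval ![0, 0, z] f = f0 + z * c ∧
      MvPolynomial.eval ![x, y, z] f =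
        f0 + x * a + y * b + z * c + x * y * p + x * z * q + y * z * r := by
  induction f using MvPolynomial.induction_on with
  | C k => exact ⟨k, 0, 0, 0, 0, 0, 0, by simp⟩
  | add f g hf hg =>
    obtain ⟨f0, a, b, c, p, q, r, h0, h1, h2, h3, h4⟩ := hf
    obtain ⟨f0', a', b', c', p', q', r', h0', h1', h2', h3', h4'⟩ := hg
    refine ⟨f0 + f0', a + a', b + b', c + c', p + p', q + q', r + r', ?_, ?_, ?_, ?_, ?_⟩ <;>
      simp only [map_add, *] <;> ring
  | mul_X f i hf =>
    obtain ⟨f0, a, b, c, p, q, r, h0, h1, h2, h3, h4⟩ := hf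
    fin_cases i
    · refine ⟨0, f0 + x * a, 0, 0, b + x * p, c + x * q, x * r, ?_, ?_, ?_, ?_, ?_⟩ <;>
        simp [*] <;> ring
    · refine ⟨0, 0, f0 + y * b, 0, a + y * p, y * q, c + y * r, ?_, ?_, ?_, ?_, ?_⟩ <;>
        simp [*] <;> ring
    · refine ⟨0, 0, 0, f0 + z * c, z * p, a + z * q, b + z * r, ?_, ?_, ?_, ?_, ?_⟩ <;>
        simp [*] <;> ring

theorem tE_split (s x y z t : R) : ∃ p q r : R,
    tE s x y z t = -8 * ((1 - s) * (1 - x) * (1 - s * x)) ^ 2 * x ^ 2 +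
      -8 * ((1 - t) * (1 - y) * (1 - y * t)) ^ 2 * y ^ 2 + -8 * (1 - z) ^ 2 * z ^ 2 +
      x * y * p + x * z * q + y * z * r := by
  obtain ⟨f0, a, b, c, p, q, r, h0, h1, h2, h3, h4⟩ := poly_split x y z
    (tE (MvPolynomial.C s) (MvPolynomial.X 0) (MvPolynomial.X 1) (MvPolynomial.X 2)
      (MvPolynomial.C t))
  simp only [map_tE, MvPolynomial.eval_C, MvPolynomial.eval_X, Matrix.cons_val_zero,
    Matrix.cons_val_one, Matrix.cons_val] at h0 h1 h2 h3 h4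
  refine ⟨p, q, r, ?_⟩
  rw [tE_zero] at h0
  rw [tE_x] at h1
  rw [tE_y] at h2
  rw [tE_z] at h3
  rw [h4, h1, h2, h3, ← h0]
  ring

/-- the valuation axioms, bundled -/
structure IsVal {K : Type*} [Field K] (val : K → WithTop ℝ) : Prop where
  h0 : ∀ x : K, val x = ⊤ ↔ x = 0
  hm : ∀ x y : K, val (x * y) = val x + val y
  ha : ∀ x y : K, min (val x) (val y) ≤ val (x + y)

namespace IsVal
variable {K : Type*} [Field K] {val : K → WithTop ℝ} (V : IsVal val)
include V

theorem ne_zero {x : K} {a : ℝ} (h : val x = (a : WithTop ℝ)) : x ≠ 0 := by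
  intro hx
  rw [(V.h0 x).2 hx] at h
  exact WithTop.coe_ne_top h.symm

theorem exists_real {x : K} (h : x ≠ 0) : ∃ a : ℝ, val x = (a : WithTop ℝ) := by
  have : val x ≠ ⊤ := fun h' => h ((V.h0 x).1 h')
  exact ⟨_, (WithTop.coe_untop _ this).symm⟩

theorem mul {x y : K} {a b : ℝ} (hx : val x = (a : WithTop ℝ)) (hy : val y = (b : WithTop ℝ)) :
    val (x * y) = ((a + b : ℝ) : WithTop ℝ) := by
  rw [V.hm, hx, hy]; rfl

theorem one : val 1 = ((0 : ℝ) : WithTop ℝ) := by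
  obtain ⟨a, h⟩ := V.exists_real (one_ne_zero : (1 : K) ≠ 0)
  have h2 := V.mul h h
  rw [mul_one, h] at h2
  have : a = a + a := by exact_mod_cast h2
  rw [h]; congr 1; linarith

theorem neg_one : val (-1) = ((0 : ℝ) : WithTop ℝ) := by
  obtain ⟨a, h⟩ := V.exists_real (neg_ne_zero.2 one_ne_zero : (-1 : K) ≠ 0)
  have h2 := V.mul h h
  rw [neg_one_mul, neg_neg, V.one] at h2
  have : 0 = a + a := by exact_mod_cast h2
  rw [h]; congr 1; linarith

theorem neg (x : K) : val (-x) = val x := by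
  rw [← neg_one_mul, V.hm, V.neg_one]
  simp

theorem pow {x : K} {a : ℝ} (hx : val x = (a : WithTop ℝ)) (n : ℕ) :
    val (x ^ n) = ((n * a : ℝ) : WithTop ℝ) := by
  induction n with
  | zero => simp [V.one]
  | succ k ih =>
    rw [pow_succ, V.mul ih hx]; congr 1; push_cast; ring

theorem div {x y : K} {a b : ℝ} (hx : val x = (a : WithTop ℝ)) (hy : val y = (b : WithTop ℝ)) :
    val (x / y) = ((a - b : ℝ) : WithTop ℝ) := by
  have hy0 := V.ne_zero hy
  have hx0 := V.ne_zero hx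
  obtain ⟨c, hc⟩ := V.exists_real (div_ne_zero hx0 hy0)
  have h2 := V.mul hc hy
  rw [div_mul_cancel₀ _ hy0, hx] at h2
  have : a = c + b := by exact_mod_cast h2
  rw [hc]; congr 1; linarith

theorem lt_add {x y : K} {c : WithTop ℝ} (hx : c < val x) (hy : c < val y) : c < val (x + y) :=
  lt_of_lt_of_le (lt_min hx hy) (V.ha x y)

theorem add_eq {x y : K} {a : ℝ} (hx : val x = (a : WithTop ℝ)) (hy : (a : WithTop ℝ) < val y) :
    val (x + y) = (a : WithTop ℝ) := by
  apply le_antisymm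
  · by_contra! h
    have := V.lt_add h (by rwa [V.neg] : (a : WithTop ℝ) < val (-y))
    rw [add_neg_cancel_right, hx] at this
    exact lt_irrefl _ this
  · have := V.ha x y
    rwa [hx, min_eq_left hy.le] at this

theorem sub_eq {x y : K} {a b : ℝ} (hx : val x = (a : WithTop ℝ)) (hy : val y = (b : WithTop ℝ))
    (hab : b < a) : val (x - y) = (b : WithTop ℝ) := by
  rw [sub_eq_add_neg, add_comm]
  exact V.add_eq (by rw [V.neg, hy]) (by rw [hx]; exact_mod_cast hab)

/-- valuation ring -/
def ring : Subring K where
  carrier := {x | 0 ≤ val x}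
  mul_mem' {a b} h h' := by
    simp only [Set.mem_ofPred_eq] at *
    rw [V.hm]; exact add_nonneg h h'
  one_mem' := by simp [V.one]
  add_mem' {a b} h h' := le_trans (le_min h h') (V.ha a b)
  zero_mem' := by simp [(V.h0 0).2 rfl]
  neg_mem' {a} h := by simpa [V.neg] using h

theorem nonneg (x : V.ring) : 0 ≤ val (x : K) := x.2

/-- maximal ideal -/
def mx : Ideal V.ring where
  carrier := {x | 0 < val (x : K)}
  add_mem' {a b} h h' := by
    simpa using V.lt_add h h'
  zero_mem' := by simp [(V.h0 0).2 rfl]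
  smul_mem' c x h := by
    simp only [Set.mem_ofPred_eq, smul_eq_mul, Subring.coe_mul] at *
    rw [V.hm]
    exact lt_of_lt_of_le h (le_add_of_nonneg_left (V.nonneg c))

theorem lift {x : K} {a : ℝ} (hx : val x = (a : WithTop ℝ)) (h : 0 < a) :
    ∃ r : V.ring, (r : K) = x ∧ Ideal.Quotient.mk V.mx r = 0 := by
  have h1 : 0 < val x := by rw [hx]; exact_mod_cast h
  exact ⟨⟨x, h1.le⟩, rfl, Ideal.Quotient.eq_zero_iff_mem.2 h1⟩

theorem val_of_res {x y : V.ring} (h : Ideal.Quotient.mk V.mx x = Ideal.Quotient.mk V.mx y)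
    (hy : val (y : K) = ((0 : ℝ) : WithTop ℝ)) : val (x : K) = ((0 : ℝ) : WithTop ℝ) := by
  have h1 : 0 < val (((x - y : V.ring)) : K) := Ideal.Quotient.eq.1 h
  have := V.add_eq hy (by exact_mod_cast h1)
  simpa using this

theorem of_mul {x y : V.ring} (h : val ((x * y : V.ring) : K) = ((0 : ℝ) : WithTop ℝ)) :
    val (x : K) = ((0 : ℝ) : WithTop ℝ) := by
  have h1 := V.nonneg x
  have h2 := V.nonneg y
  rw [Subring.coe_mul, V.hm] at h
  apply le_antisymm _ (by exact_mod_cast h1)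
  rw [← h]
  exact le_add_of_nonneg_right h2

theorem lt_mul3 {x y : K} {a b k : ℝ} (hx : val x = (a : WithTop ℝ))
    (hy : val y = (b : WithTop ℝ)) (p : V.ring) (hk : k < a + b) :
    (k : WithTop ℝ) < val (x * y * (p : K)) := by
  rw [V.hm, V.mul hx hy]
  exact lt_of_lt_of_le (by exact_mod_cast hk) (le_add_of_nonneg_right (V.nonneg p))

theorem dom {x y z : K} {a b c : ℝ} (hx : val x = (a : WithTop ℝ))
    (hy : val y = (b : WithTop ℝ)) (hz : val z = (c : WithTop ℝ)) (hb : a < b) (hc : a < c)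
    (u v w p q r : V.ring) (hu : val (u : K) = ((0 : ℝ) : WithTop ℝ)) :
    val (u * x ^ 2 + v * y ^ 2 + w * z ^ 2 + x * y * p + x * z * q + y * z * r) =
      ((2 * a : ℝ) : WithTop ℝ) := by
  have h1 : val (u * x ^ 2) = ((2 * a : ℝ) : WithTop ℝ) := by
    rw [V.mul hu (V.pow hx 2)]; congr 1; push_cast; ring
  have h2 := V.add_eq h1 (V.lt_add (V.lt_add (V.lt_add (V.lt_add
    (V.lt_mul3 hy hy v (by linarith)) (V.lt_mul3 hz hz w (by linarith)))
    (V.lt_mul3 hx hy p (by linarith))) (V.lt_mul3 hx hz q (by linarith)))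
    (V.lt_mul3 hy hz r (by linarith)))
  rw [← h2]; congr 1; ring

end IsVal

theorem IsVal.val_dlt {K : Type*} [Field K] {val : K → WithTop ℝ} (V : IsVal val) {x y : K} {e : ℝ}
    (h : val (x - y) = (e : WithTop ℝ)) : val (dlt x y) = ((2 * e : ℝ) : WithTop ℝ) := by
  rw [Genus2Igusa.dlt, V.pow h 2]; norm_num

theorem IsVal.D {K : Type*} [Field K] {val : K → WithTop ℝ} (V : IsVal val)
    {a1 a2 a3 a4 a5 a6 : K} {e12 e13 e14 e15 e16 e23 e24 e25 e26 e34 e35 e36 e45 e46 e56 : ℝ}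
    (h12 : val (a1 - a2) = (e12 : WithTop ℝ))
    (h13 : val (a1 - a3) = (e13 : WithTop ℝ))
    (h14 : val (a1 - a4) = (e14 : WithTop ℝ))
    (h15 : val (a1 - a5) = (e15 : WithTop ℝ))
    (h16 : val (a1 - a6) = (e16 : WithTop ℝ))
    (h23 : val (a2 - a3) = (e23 : WithTop ℝ))
    (h24 : val (a2 - a4) = (e24 : WithTop ℝ))
    (h25 : val (a2 - a5) = (e25 : WithTop ℝ))
    (h26 : val (a2 - a6) = (e26 : WithTop ℝ))
    (h34 : val (a3 - a4) = (e34 : WithTop ℝ))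
    (h35 : val (a3 - a5) = (e35 : WithTop ℝ))
    (h36 : val (a3 - a6) = (e36 : WithTop ℝ))
    (h45 : val (a4 - a5) = (e45 : WithTop ℝ))
    (h46 : val (a4 - a6) = (e46 : WithTop ℝ))
    (h56 : val (a5 - a6) = (e56 : WithTop ℝ)) :
    val (igusaD a1 a2 a3 a4 a5 a6) =
      ((2 * (e12 + e13 + e14 + e15 + e16 + e23 + e24 + e25 + e26 + e34 + e35 + e36 + e45 + e46 + e56) : ℝ) : WithTop ℝ) := by
  rw [igusaD, (V.mul (V.mul (V.mul (V.mul (V.mul (V.mul (V.mul (V.mul (V.mul (V.mul (V.mul (V.mul (V.mul (V.mul (V.val_dlt h12) (V.val_dlt h13)) (V.val_dlt h14)) (V.val_dlt h15)) (V.val_dlt h16)) (V.val_dlt h23)) (V.val_dlt h24)) (V.val_dlt h25)) (V.val_dlt h26)) (V.val_dlt h34)) (V.val_dlt h35)) (V.val_dlt h36)) (V.val_dlt h45)) (V.val_dlt h46)) (V.val_dlt h56))]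
  congr 1; ring

theorem IsVal.dumbbell {K : Type*} [Field K] {val : K → WithTop ℝ} (V : IsVal val)
    {a1 a2 a3 a4 a5 a6 : K} {w1 w2 w3 w4 w5 w6 : ℝ}
    (v1 : val a1 = ((-w1 : ℝ) : WithTop ℝ)) (v2 : val a2 = ((-w2 : ℝ) : WithTop ℝ))
    (v3 : val a3 = ((-w3 : ℝ) : WithTop ℝ)) (v4 : val a4 = ((-w4 : ℝ) : WithTop ℝ))
    (v5 : val a5 = ((-w5 : ℝ) : WithTop ℝ)) (v6 : val a6 = ((-w6 : ℝ) : WithTop ℝ))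
    (h1 : w1 < w2) (h2 : w2 < w3) (h3 : w3 < w4) (h4 : w4 < w5) (h5 : w5 < w6)
    (v : val 6 = ((0 : ℝ) : WithTop ℝ)) :
    val (igusaA a1 a2 a3 a4 a5 a6 ^ 2 * (igusaA a1 a2 a3 a4 a5 a6 * igusaB a1 a2 a3 a4 a5 a6 -
      4 * igusaC a1 a2 a3 a4 a5 a6) / igusaD a1 a2 a3 a4 a5 a6) =
      ((-(2 * w5 + 2 * w4 - 2 * w3 - 2 * w2) : ℝ) : WithTop ℝ) ∧
    val (igusaA a1 a2 a3 a4 a5 a6 ^ 2 * igusaC a1 a2 a3 a4 a5 a6 / igusaD a1 a2 a3 a4 a5 a6) =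
      ((-(2 * w5 + 2 * w4 - 2 * w3 - 2 * w2) : ℝ) : WithTop ℝ) := by
  have n2 := V.ne_zero v2
  have n3 := V.ne_zero v3
  have n4 := V.ne_zero v4
  have n5 := V.ne_zero v5
  have n6 := V.ne_zero v6
  obtain ⟨r1, c1, m1⟩ := V.lift (V.div v1 v2) (by linarith)
  obtain ⟨r2, c2, m2⟩ := V.lift (V.div v2 v3) (by linarith)
  obtain ⟨r3, c3, m3⟩ := V.lift (V.div v3 v4) (by linarith)
  obtain ⟨r4, c4, m4⟩ := V.lift (V.div v4 v5) (by linarith)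
  obtain ⟨r5, c5, m5⟩ := V.lift (V.div v5 v6) (by linarith)
  have hr3 : val (r3 : K) = ((w4 - w3 : ℝ) : WithTop ℝ) := by
    rw [c3, V.div v3 v4]; congr 1; ring
  have k2 : ((2 : V.ring) : K) = 2 := map_ofNat V.ring.subtype 2
  have k3 : ((3 : V.ring) : K) = 3 := map_ofNat V.ring.subtype 3
  have k6 : ((6 : V.ring) : K) = 6 := map_ofNat V.ring.subtype 6
  have k8 : ((8 : V.ring) : K) = 8 := map_ofNat V.ring.subtype 8
  have v8 : val ((8 : V.ring) : K) = ((0 : ℝ) : WithTop ℝ) := by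
    have : val ((2 : V.ring) : K) = ((0 : ℝ) : WithTop ℝ) := by
      apply V.of_mul (y := 3)
      rw [← v]; congr 1; push_cast; rw [k2, k3]; norm_num
    have h := V.pow this 3
    rw [show ((8 : V.ring) : K) = ((2 : V.ring) : K) ^ 3 by rw [k2, k8]; norm_num, h]; simp
  have vA : val ((bA r1 r2 r3 r4 r5 : V.ring) : K) = ((0 : ℝ) : WithTop ℝ) := by
    apply V.val_of_res (y := 6) _ (by rw [k6, v])
    rw [map_bA, m1, m2, m3, m4, m5, bA_zero, map_ofNat]
  have vC : val ((bC r1 r2 r3 r4 r5 : V.ring) : K) = ((0 : ℝ) : WithTop ℝ) := by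
    apply V.val_of_res (y := 8) _ v8
    rw [map_bC, m1, m2, m3, m4, m5, bC_zero, map_ofNat]
  have vE : val ((bE r1 r2 r3 r4 r5 : V.ring) : K) = ((0 : ℝ) : WithTop ℝ) := by
    apply V.val_of_res (y := -8) _ (by rw [Subring.coe_neg, V.neg, v8])
    rw [map_bE, m1, m2, m3, m4, m5, bE_zero, map_neg, map_ofNat]
  have eA := map_bA V.ring.subtype r1 r2 r3 r4 r5
  have eC := map_bC V.ring.subtype r1 r2 r3 r4 r5
  have eE := map_bE V.ring.subtype r1 r2 r3 r4 r5
  simp only [Subring.subtype_apply] at eA eC eE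
  rw [eA] at vA
  rw [eC] at vC
  rw [eE] at vE
  have vD := V.D
    (V.sub_eq v1 v2 (by linarith))
    (V.sub_eq v1 v3 (by linarith))
    (V.sub_eq v1 v4 (by linarith))
    (V.sub_eq v1 v5 (by linarith))
    (V.sub_eq v1 v6 (by linarith))
    (V.sub_eq v2 v3 (by linarith))
    (V.sub_eq v2 v4 (by linarith))
    (V.sub_eq v2 v5 (by linarith))
    (V.sub_eq v2 v6 (by linarith))
    (V.sub_eq v3 v4 (by linarith))
    (V.sub_eq v3 v5 (by linarith))
    (V.sub_eq v3 v6 (by linarith))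
    (V.sub_eq v4 v5 (by linarith))
    (V.sub_eq v4 v6 (by linarith))
    (V.sub_eq v5 v6 (by linarith))
  generalize (r1 : K) = r1 at *
  generalize (r2 : K) = r2 at *
  generalize (r3 : K) = r3 at *
  generalize (r4 : K) = r4 at *
  generalize (r5 : K) = r5 at *
  have sc := scale a1 a2 a3 a4 a5 a6 a4 (a5 ^ 2 / a4) (a6 ^ 2 / a4) (r3 ^ 2)
    (r2 ^ 2 * (1 - r1) ^ 2) ((1 - r1 * r2) ^ 2) ((1 - r1 * r2 * r3) ^ 2) ((1 - r1 * r2 * r3 * r4) ^ 2) ((1 - r1 * r2 * r3 * r4 * r5) ^ 2)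
      ((1 - r2) ^ 2) ((1 - r2 * r3) ^ 2) ((1 - r2 * r3 * r4) ^ 2) ((1 - r2 * r3 * r4 * r5) ^ 2) ((1 - r3) ^ 2)
      ((1 - r3 * r4) ^ 2) ((1 - r3 * r4 * r5) ^ 2) ((1 - r4) ^ 2) ((1 - r4 * r5) ^ 2) (r4 ^ 2 * (1 - r5) ^ 2)
  simp only [Genus2Igusa.dlt] at sc
  obtain ⟨sA, sB, sC⟩ := sc (by rw [c1, c2, c3]; field_simp; try ring) (by rw [c1, c2, c3]; field_simp; try ring)
    (by rw [c1, c2, c3]; field_simp; try ring) (by rw [c1, c2, c3, c4]; field_simp; try ring)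
    (by rw [c1, c2, c3, c4, c5]; field_simp; try ring) (by rw [c2, c3]; field_simp; try ring)
    (by rw [c2, c3]; field_simp; try ring) (by rw [c2, c3, c4]; field_simp; try ring)
    (by rw [c2, c3, c4, c5]; field_simp; try ring) (by rw [c3]; field_simp; try ring) (by rw [c3, c4]; field_simp; try ring)
    (by rw [c3, c4, c5]; field_simp; try ring) (by rw [c4]; field_simp; try ring) (by rw [c4, c5]; field_simp; try ring)
    (by rw [c4, c5]; field_simp; try ring)
  rw [← bA] at sA
  rw [← bC] at sC
  have sE : igusaA a1 a2 a3 a4 a5 a6 * igusaB a1 a2 a3 a4 a5 a6 - 4 * igusaC a1 a2 a3 a4 a5 a6 =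
      (a4 ^ 4 * (a5 ^ 2 / a4) * (a6 ^ 2 / a4)) ^ 3 * r3 ^ 2 * bE r1 r2 r3 r4 r5 := by
    rw [sA, sB, sC, bE, hE, bA, bC]; ring
  have vp := V.mul (V.mul (V.pow v4 4) (V.div (V.pow v5 2) v4)) (V.div (V.pow v6 2) v4)
  have vA' := V.mul vp vA
  have vE' := V.mul (V.mul (V.pow vp 3) (V.pow hr3 2)) vE
  have vC' := V.mul (V.mul (V.pow vp 3) (V.pow hr3 2)) vC
  rw [← sA] at vA'
  rw [← sE] at vE'
  rw [← sC] at vC'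
  constructor
  · rw [V.div (V.mul (V.pow vA' 2) vE') vD]; congr 1; push_cast; ring
  · rw [V.div (V.mul (V.pow vA' 2) vC') vD]; congr 1; push_cast; ring

theorem IsVal.theta {K : Type*} [Field K] {val : K → WithTop ℝ} (V : IsVal val)
    {a1 a2 a3 a4 a5 a6 : K} {w1 w2 w3 w5 w6 d k : ℝ}
    (v1 : val a1 = ((-w1 : ℝ) : WithTop ℝ)) (v2 : val a2 = ((-w2 : ℝ) : WithTop ℝ))
    (v3 : val a3 = ((-w3 : ℝ) : WithTop ℝ)) (v4 : val a4 = ((-w3 : ℝ) : WithTop ℝ))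
    (v5 : val a5 = ((-w5 : ℝ) : WithTop ℝ)) (v6 : val a6 = ((-w6 : ℝ) : WithTop ℝ))
    (v34 : val (a3 - a4) = ((-d : ℝ) : WithTop ℝ))
    (h1 : w1 < w2) (h2 : w2 < w3) (h4 : w3 < w5) (h5 : w5 < w6) (hd : d < w3)
    (v : val 2 = ((0 : ℝ) : WithTop ℝ))
    (hk : (w3 - d < w5 - w3 ∧ w3 - d < w3 - w2 ∧ k = w3 - d) ∨
      (w5 - w3 < w3 - d ∧ w5 - w3 < w3 - w2 ∧ k = w5 - w3) ∨
      (w3 - w2 < w3 - d ∧ w3 - w2 < w5 - w3 ∧ k = w3 - w2)) :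
    val (igusaA a1 a2 a3 a4 a5 a6 ^ 2 * (igusaA a1 a2 a3 a4 a5 a6 * igusaB a1 a2 a3 a4 a5 a6 -
      4 * igusaC a1 a2 a3 a4 a5 a6) / igusaD a1 a2 a3 a4 a5 a6) =
      ((-(2 * (w3 - d) + 2 * (w5 - w3) + 2 * (w3 - w2) - 2 * k) : ℝ) : WithTop ℝ) := by
  have n2 := V.ne_zero v2
  have n3 := V.ne_zero v3
  have n5 := V.ne_zero v5
  have n6 := V.ne_zero v6
  obtain ⟨s, c1, m1⟩ := V.lift (V.div v1 v2) (by linarith)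
  obtain ⟨x, c2, m2⟩ := V.lift (V.div v2 v3) (by linarith)
  obtain ⟨y, c3, m3⟩ := V.lift (V.div v3 v5) (by linarith)
  obtain ⟨z, c4, m4⟩ := V.lift (V.div v34 v3) (by linarith)
  obtain ⟨t, c5, m5⟩ := V.lift (V.div v5 v6) (by linarith)
  have hx : val (x : K) = ((w3 - w2 : ℝ) : WithTop ℝ) := by
    rw [c2, V.div v2 v3]; congr 1; ring
  have hy : val (y : K) = ((w5 - w3 : ℝ) : WithTop ℝ) := by
    rw [c3, V.div v3 v5]; congr 1; ring
  have hz : val (z : K) = ((w3 - d : ℝ) : WithTop ℝ) := by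
    rw [c4, V.div v34 v3]; congr 1; ring
  have k2 : ((2 : V.ring) : K) = 2 := map_ofNat V.ring.subtype 2
  have k8 : ((8 : V.ring) : K) = 8 := map_ofNat V.ring.subtype 8
  have v8 : val ((8 : V.ring) : K) = ((0 : ℝ) : WithTop ℝ) := by
    have h := V.pow v 3
    rw [show ((8 : V.ring) : K) = 2 ^ 3 by rw [k8]; norm_num, h]; simp
  have v8' : val ((-8 : V.ring) : K) = ((0 : ℝ) : WithTop ℝ) := by
    rw [Subring.coe_neg, V.neg, v8]
  have vA : val ((tA s x y z t : V.ring) : K) = ((0 : ℝ) : WithTop ℝ) := by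
    apply V.val_of_res (y := 8) _ v8
    rw [map_tA, m1, m2, m3, m4, m5, tA_zero, map_ofNat]
  have vE : val ((tE s x y z t : V.ring) : K) = ((2 * k : ℝ) : WithTop ℝ) := by
    obtain ⟨p, q, r, h⟩ := tE_split s x y z t
    have hu := V.val_of_res (x := -8 * ((1 - s) * (1 - x) * (1 - s * x)) ^ 2) (by simp [*]) v8'
    have hv := V.val_of_res (x := -8 * ((1 - t) * (1 - y) * (1 - y * t)) ^ 2) (by simp [*]) v8'
    have hw := V.val_of_res (x := -8 * (1 - z) ^ 2) (by simp [*]) v8'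
    rw [h]
    generalize -8 * ((1 - s) * (1 - x) * (1 - s * x)) ^ 2 = u at *
    generalize -8 * ((1 - t) * (1 - y) * (1 - y * t)) ^ 2 = v at *
    generalize -8 * (1 - z) ^ 2 = w at *
    simp only [Subring.coe_add, Subring.coe_mul, Subring.coe_pow]
    rcases hk with ⟨i1, i2, i3⟩ | ⟨i1, i2, i3⟩ | ⟨i1, i2, i3⟩
    · rw [i3, ← V.dom hz hx hy i2 i1 w u v q r p hw]; congr 1; ring
    · rw [i3, ← V.dom hy hx hz i2 i1 v u w p r q hv]; congr 1; ring
    · rw [i3, ← V.dom hx hy hz i2 i1 u v w p q r hu]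
  have eA := map_tA V.ring.subtype s x y z t
  have eE := map_tE V.ring.subtype s x y z t
  simp only [Subring.subtype_apply] at eA eE
  rw [eA] at vA
  rw [eE] at vE
  have vD := V.D
    (V.sub_eq v1 v2 (by linarith))
    (V.sub_eq v1 v3 (by linarith))
    (V.sub_eq v1 v4 (by linarith))
    (V.sub_eq v1 v5 (by linarith))
    (V.sub_eq v1 v6 (by linarith))
    (V.sub_eq v2 v3 (by linarith))
    (V.sub_eq v2 v4 (by linarith))
    (V.sub_eq v2 v5 (by linarith))
    (V.sub_eq v2 v6 (by linarith))
    v34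
    (V.sub_eq v3 v5 (by linarith))
    (V.sub_eq v3 v6 (by linarith))
    (V.sub_eq v4 v5 (by linarith))
    (V.sub_eq v4 v6 (by linarith))
    (V.sub_eq v5 v6 (by linarith))
  generalize (s : K) = s at *
  generalize (x : K) = x at *
  generalize (y : K) = y at *
  generalize (z : K) = z at *
  generalize (t : K) = t at *
  have sc := scale a1 a2 a3 a4 a5 a6 a3 (a5 ^ 2 / a3) (a6 ^ 2 / a3) 1
    (x ^ 2 * (1 - s) ^ 2) ((1 - s * x) ^ 2) ((1 - z - s * x) ^ 2) ((1 - s * x * y) ^ 2) ((1 - s * x * y * t) ^ 2)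
      ((1 - x) ^ 2) ((1 - z - x) ^ 2) ((1 - x * y) ^ 2) ((1 - x * y * t) ^ 2) (z ^ 2)
      ((1 - y) ^ 2) ((1 - y * t) ^ 2) ((1 - (1 - z) * y) ^ 2) ((1 - (1 - z) * y * t) ^ 2) (y ^ 2 * (1 - t) ^ 2)
  simp only [Genus2Igusa.dlt] at sc
  obtain ⟨sA, sB, sC⟩ := sc
    (by rw [c1, c2]; field_simp; try ring)
    (by rw [c1, c2]; field_simp; try ring)
    (by rw [c1, c2, c4]; field_simp; try ring)
    (by rw [c1, c2, c3]; field_simp; try ring)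
    (by rw [c1, c2, c3, c5]; field_simp; try ring)
    (by rw [c2]; field_simp; try ring)
    (by rw [c2, c4]; field_simp; try ring)
    (by rw [c2, c3]; field_simp; try ring)
    (by rw [c2, c3, c5]; field_simp; try ring)
    (by rw [c4]; field_simp; try ring)
    (by rw [c3]; field_simp; try ring)
    (by rw [c3, c5]; field_simp; try ring)
    (by rw [c3, c4]; field_simp; try ring)
    (by rw [c3, c4, c5]; field_simp; try ring)
    (by rw [c3, c5]; field_simp; try ring)
  rw [← tA] at sA
  have sE : igusaA a1 a2 a3 a4 a5 a6 * igusaB a1 a2 a3 a4 a5 a6 - 4 * igusaC a1 a2 a3 a4 a5 a6 =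
      (a3 ^ 4 * (a5 ^ 2 / a3) * (a6 ^ 2 / a3)) ^ 3 * tE s x y z t := by
    rw [sA, sB, sC, tE, hE, tA]; ring
  have vp := V.mul (V.mul (V.pow v3 4) (V.div (V.pow v5 2) v3)) (V.div (V.pow v6 2) v3)
  have vA' := V.mul vp vA
  have vE' := V.mul (V.pow vp 3) vE
  rw [← sA] at vA'
  rw [← sE] at vE'
  rw [V.div (V.mul (V.pow vA' 2) vE') vD]; congr 1; push_cast; ring

/-- **Tropicalization of the new Igusa invariant `j₄ = j₂ − 4j₃ = A²(A·B − 4C)/D`.**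
(i) On the dumbbell cone (`ω₁ < ⋯ < ω₆`, `val 6 = 0`):
`−val j₄ = L₁ + 8L₀ + L₂ = −val j₃`.
(ii) On the theta cone (`ω₁ < ω₂ < ω₃ = ω₄ < ω₅ < ω₆`, `d₃₄ < ω₃`, `val 2 = 0`), if
the minimum of `{L₀, L₁, L₂}` is attained exactly once, then
`−val j₄ = L₀ + L₁ + L₂ − min {L₀, L₁, L₂}`. -/
theorem tropicalization_of_j4
    {K : Type*} [Field K] (val : K → WithTop ℝ)
    (hval0 : ∀ x : K, val x = ⊤ ↔ x = 0)
    (hvalmul : ∀ x y : K, val (x * y) = val x + val y)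
    (hvaladd : ∀ x y : K, min (val x) (val y) ≤ val (x + y))
    (a₁ a₂ a₃ a₄ a₅ a₆ : K)
    (hdist : List.Pairwise (· ≠ ·) [a₁, a₂, a₃, a₄, a₅, a₆])
    (hne : ∀ a ∈ [a₁, a₂, a₃, a₄, a₅, a₆], a ≠ 0)
    (ω₁ ω₂ ω₃ ω₄ ω₅ ω₆ : ℝ)
    (hω₁ : val a₁ = ((-ω₁ : ℝ) : WithTop ℝ)) (hω₂ : val a₂ = ((-ω₂ : ℝ) : WithTop ℝ))
    (hω₃ : val a₃ = ((-ω₃ : ℝ) : WithTop ℝ)) (hω₄ : val a₄ = ((-ω₄ : ℝ) : WithTop ℝ))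
    (hω₅ : val a₅ = ((-ω₅ : ℝ) : WithTop ℝ)) (hω₆ : val a₆ = ((-ω₆ : ℝ) : WithTop ℝ)) :
    let A := igusaA a₁ a₂ a₃ a₄ a₅ a₆
    let B := igusaB a₁ a₂ a₃ a₄ a₅ a₆
    let C := igusaC a₁ a₂ a₃ a₄ a₅ a₆
    let D := igusaD a₁ a₂ a₃ a₄ a₅ a₆
    -- (i) dumbbell cone
    ((ω₁ < ω₂ ∧ ω₂ < ω₃ ∧ ω₃ < ω₄ ∧ ω₄ < ω₅ ∧ ω₅ < ω₆ ∧
        val (6 : K) = (0 : WithTop ℝ)) →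
      ∀ L₀ L₁ L₂ : ℝ, L₀ = (ω₄ - ω₃) / 2 → L₁ = 2 * (ω₅ - ω₄) → L₂ = 2 * (ω₃ - ω₂) →
        val (A ^ 2 * (A * B - 4 * C) / D) = ((-(L₁ + 8 * L₀ + L₂) : ℝ) : WithTop ℝ) ∧
        val (A ^ 2 * C / D) = ((-(L₁ + 8 * L₀ + L₂) : ℝ) : WithTop ℝ)) ∧
    -- (ii) theta cone
    (∀ d₃₄ : ℝ,
      (ω₁ < ω₂ ∧ ω₂ < ω₃ ∧ ω₃ = ω₄ ∧ ω₄ < ω₅ ∧ ω₅ < ω₆ ∧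
        val (a₃ - a₄) = ((-d₃₄ : ℝ) : WithTop ℝ) ∧ d₃₄ < ω₃ ∧
        val (2 : K) = (0 : WithTop ℝ)) →
      ∀ L₀ L₁ L₂ : ℝ, L₀ = 2 * (ω₃ - d₃₄) → L₁ = 2 * (ω₅ - ω₃) → L₂ = 2 * (ω₃ - ω₂) →
        ((L₀ < L₁ ∧ L₀ < L₂) ∨ (L₁ < L₀ ∧ L₁ < L₂) ∨ (L₂ < L₀ ∧ L₂ < L₁)) →
        val (A ^ 2 * (A * B - 4 * C) / D) =
          ((-(L₀ + L₁ + L₂ - min L₀ (min L₁ L₂)) : ℝ) : WithTop ℝ)) := by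
  have V : IsVal val := ⟨hval0, hvalmul, hvaladd⟩
  intro A B C D
  constructor
  · rintro ⟨h1, h2, h3, h4, h5, v⟩ L₀ L₁ L₂ e0 e1 e2
    have h := V.dumbbell hω₁ hω₂ hω₃ hω₄ hω₅ hω₆ h1 h2 h3 h4 h5 v
    have e : L₁ + 8 * L₀ + L₂ = 2 * ω₅ + 2 * ω₄ - 2 * ω₃ - 2 * ω₂ := by
      rw [e0, e1, e2]; ring
    rw [e]
    exact h
  · rintro d ⟨h1, h2, h3, h4, h5, v34, hd, v⟩ L₀ L₁ L₂ e0 e1 e2 hL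
    subst h3
    have h := V.theta (k := min L₀ (min L₁ L₂) / 2) hω₁ hω₂ hω₃ hω₄ hω₅ hω₆ v34 h1 h2 h4 h5 hd v (by
      rcases hL with ⟨i1, i2⟩ | ⟨i1, i2⟩ | ⟨i1, i2⟩
      · left
        rw [min_eq_left (le_min i1.le i2.le)]
        refine ⟨?_, ?_, ?_⟩ <;> linarith
      · right; left
        rw [min_eq_left i2.le, min_eq_right i1.le]
        refine ⟨?_, ?_, ?_⟩ <;> linarith
      · right; right
        rw [min_eq_right i2.le, min_eq_right i1.le]
        refine ⟨?_, ?_, ?_⟩ <;> linarith)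
    have e : L₀ + L₁ + L₂ - min L₀ (min L₁ L₂) = 2 * (ω₃ - d) + 2 * (ω₅ - ω₃) + 2 * (ω₃ - ω₂) -
        2 * (min L₀ (min L₁ L₂) / 2) := by
      rw [← e0, ← e1, ← e2]; ring
    rw [e]
    exact h

end Genus2Igusa
end
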